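/- arXiv:2403.00392 — 2 statements merged into one kernel-verified Lean document; each statement's English description precedes it below -/
import Mathlib

section
/- Let p₁,p₂,p₃,q₁,q₂,q₃ ∈ ℂ² be such that p₁,p₂,p₃ are not collinear (the vectors p₂−p₁ and p₃−p₁ are linearly independent over ℂ) and d(p_v,p_w) ≠ d(q_v,q_w) for all distinct v,w ∈ {1,2,3}. Then the set Γ := {(p₀,q₀) ∈ ℂ² × ℂ² : d(p₀,p_w) = d(q₀,q_w) for w = 1,2,3}, regarded as a subset of ℂ⁴, is irreducible and has dimension 1. -/
noncomputable section

/-- The squared distance function on `ℂ²`. -/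
def sd (x y : ℂ × ℂ) : ℂ := (x.1 - y.1) ^ 2 + (x.2 - y.2) ^ 2

/-- Membership in the transformation group `T`. -/
def IsTransf (t : ℂ × ℂ → ℂ × ℂ) : Prop :=
  ∃ c s u v : ℂ, c ^ 2 + s ^ 2 = 1 ∧
    ∀ x, t x = (c * x.1 - s * x.2 + u, s * x.1 + c * x.2 + v)

/-- A point of `ℂ² × ℂ²` viewed as a point of `ℂ⁴`. -/
def pt4 (p : (ℂ × ℂ) × (ℂ × ℂ)) : Fin 4 → ℂ := ![p.1.1, p.1.2, p.2.1, p.2.2]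

/-- The vanishing ideal of a subset of `ℂ² × ℂ² = ℂ⁴` in `ℂ[x₁, x₂, x₃, x₄]`. -/
def vanIdeal4 (S : Set ((ℂ × ℂ) × (ℂ × ℂ))) : Ideal (MvPolynomial (Fin 4) ℂ) where
  carrier := {f | ∀ p ∈ S, MvPolynomial.eval (pt4 p) f = 0}
  add_mem' := by
    intro a b ha hb p hp
    simp only [Set.mem_setOf_eq] at ha hb ⊢
    simp [map_add, ha p hp, hb p hp]
  zero_mem' := by intro p hp; simp
  smul_mem' := by
    intro c f hf p hp
    simp only [Set.mem_setOf_eq] at hf ⊢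
    simp [smul_eq_mul, map_mul, hf p hp]

/-- A subset of `ℂ⁴` is irreducible if its vanishing ideal is prime. -/
def IsIrr4 (S : Set ((ℂ × ℂ) × (ℂ × ℂ))) : Prop := (vanIdeal4 S).IsPrime

/-- The dimension of a subset of `ℂ⁴`: the Krull dimension of the quotient of
`ℂ[x₁, x₂, x₃, x₄]` by its vanishing ideal. -/
def dim4 (S : Set ((ℂ × ℂ) × (ℂ × ℂ))) : WithBot (WithTop ℕ) :=
  ringKrullDim (MvPolynomial (Fin 4) ℂ ⧸ vanIdeal4 S)

end

/-- `Γ` for three base points: pairs `(p₀, q₀)` with `d(p₀, p_w) = d(q₀, q_w)`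
for `w = 1, 2, 3`. -/
def Gamma3 (p1 p2 p3 q1 q2 q3 : ℂ × ℂ) : Set ((ℂ × ℂ) × (ℂ × ℂ)) :=
  {pq | sd pq.1 p1 = sd pq.2 q1 ∧ sd pq.1 p2 = sd pq.2 q2 ∧
    sd pq.1 p3 = sd pq.2 q3}

/-- View `(z₁, z₂, z₃, z₄)` as the rows of a `2 × 2` matrix. If `n` and `z` are singular and
orthogonal for the polarized determinant, then their first columns or their first rows are
proportional. -/
lemma isotropic_orthogonal_dichotomy {n1 n2 n3 n4 z1 z2 z3 z4 : ℂ}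
    (hn : n1 * n4 = n2 * n3) (hz : z1 * z4 = z2 * z3)
    (hzn : z1 * n4 + z4 * n1 = z2 * n3 + z3 * n2) :
    z1 * n3 = z3 * n1 ∨ z1 * n2 = z2 * n1 := by
  have h : (z1 * n3 - z3 * n1) * (z1 * n2 - z2 * n1) = 0 := by
    linear_combination (-z1 ^ 2) * hn - n1 ^ 2 * hz + z1 * n1 * hzn
  rcases mul_eq_zero.mp h with h | h
  · exact Or.inl (sub_eq_zero.mp h)
  · exact Or.inr (sub_eq_zero.mp h)

/-- A matrix orthogonal to a singular matrix, with proportional first column, is singular. -/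
lemma isotropic_of_column {n1 n2 n3 n4 w1 w2 w3 w4 : ℂ} (h0 : n1 ≠ 0)
    (hn : n1 * n4 = n2 * n3) (hwn : w1 * n4 + w4 * n1 = w2 * n3 + w3 * n2)
    (h : w1 * n3 = w3 * n1) : w1 * w4 = w2 * w3 := by
  have h4 : w4 * n1 = w2 * n3 := by
    have : n1 * (w4 * n1 - w2 * n3) = 0 := by
      linear_combination n1 * hwn - w1 * hn - n2 * h
    exact sub_eq_zero.mp ((mul_eq_zero.mp this).resolve_left h0)
  apply mul_left_cancel₀ h0
  linear_combination w1 * h4 + w2 * h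

lemma exists_isotropic_sub_of_ne_zero {n1 n2 n3 n4 : ℂ} (h0 : n1 ≠ 0) (hn : n1 * n4 = n2 * n3)
    (z1 z2 z3 z4 : Fin 3 → ℂ) (hz : ∀ i, z1 i * z4 i = z2 i * z3 i)
    (hzn : ∀ i, z1 i * n4 + z4 i * n1 = z2 i * n3 + z3 i * n2) :
    ∃ i j, i < j ∧ (z1 i - z1 j) * (z4 i - z4 j) = (z2 i - z2 j) * (z3 i - z3 j) := by
  have col : ∀ i j, z1 i * n3 = z3 i * n1 → z1 j * n3 = z3 j * n1 →
      (z1 i - z1 j) * (z4 i - z4 j) = (z2 i - z2 j) * (z3 i - z3 j) := fun i j hi hj =>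
    isotropic_of_column h0 hn (by linear_combination hzn i - hzn j) (by linear_combination hi - hj)
  have row : ∀ i j, z1 i * n2 = z2 i * n1 → z1 j * n2 = z2 j * n1 →
      (z1 i - z1 j) * (z4 i - z4 j) = (z2 i - z2 j) * (z3 i - z3 j) := fun i j hi hj =>
    (isotropic_of_column (n2 := n3) (n3 := n2) (n4 := n4) h0 (by linear_combination hn)
      (by linear_combination hzn i - hzn j) (by linear_combination hi - hj)).trans (mul_comm _ _)
  have d := fun i => isotropic_orthogonal_dichotomy hn (hz i) (hzn i)
  rcases d 0 with a | a <;> rcases d 1 with b | b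
  · exact ⟨0, 1, by decide, col _ _ a b⟩
  · rcases d 2 with c | c
    · exact ⟨0, 2, by decide, col _ _ a c⟩
    · exact ⟨1, 2, by decide, row _ _ b c⟩
  · rcases d 2 with c | c
    · exact ⟨1, 2, by decide, col _ _ b c⟩
    · exact ⟨0, 2, by decide, row _ _ a c⟩
  · exact ⟨0, 1, by decide, row _ _ a b⟩

/-- Among three singular matrices orthogonal to a nonzero singular matrix, two have a singular
difference. -/
lemma exists_isotropic_sub {n1 n2 n3 n4 : ℂ} (h0 : n1 ≠ 0 ∨ n2 ≠ 0 ∨ n3 ≠ 0 ∨ n4 ≠ 0)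
    (hn : n1 * n4 = n2 * n3)
    (z1 z2 z3 z4 : Fin 3 → ℂ) (hz : ∀ i, z1 i * z4 i = z2 i * z3 i)
    (hzn : ∀ i, z1 i * n4 + z4 i * n1 = z2 i * n3 + z3 i * n2) :
    ∃ i j, i < j ∧ (z1 i - z1 j) * (z4 i - z4 j) = (z2 i - z2 j) * (z3 i - z3 j) := by
  rcases h0 with h | h | h | h
  · exact exists_isotropic_sub_of_ne_zero h hn z1 z2 z3 z4 hz hzn
  · obtain ⟨i, j, hij, e⟩ := exists_isotropic_sub_of_ne_zero h hn.symm z2 z1 z4 z3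
      (fun i => (hz i).symm) (fun i => (hzn i).symm)
    exact ⟨i, j, hij, e.symm⟩
  · obtain ⟨i, j, hij, e⟩ := exists_isotropic_sub_of_ne_zero (n1 := n3) (n2 := n1) (n3 := n4) (n4 := n2) h
      (by linear_combination -hn) z3 z1 z4 z2
      (fun i => by linear_combination -hz i) (fun i => by linear_combination -hzn i)
    exact ⟨i, j, hij, by linear_combination -e⟩
  · obtain ⟨i, j, hij, e⟩ := exists_isotropic_sub_of_ne_zero (n1 := n4) (n2 := n2) (n3 := n3) (n4 := n1) h
      (by linear_combination hn) z4 z2 z3 z1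
      (fun i => by linear_combination hz i) (fun i => by linear_combination hzn i)
    exact ⟨i, j, hij, by linear_combination e⟩

/-- If two families of three points have no equal distances, `Γ` contains no line. -/
lemma not_line_subset_Gamma3 {p1 p2 p3 q1 q2 q3 : ℂ × ℂ}
    (h12 : sd p1 p2 ≠ sd q1 q2) (h13 : sd p1 p3 ≠ sd q1 q3) (h23 : sd p2 p3 ≠ sd q2 q3)
    (x v y u : ℂ × ℂ) (hu : u ≠ 0) :
    ¬ ∀ t : ℂ, (x + t • v, y + t • u) ∈ Gamma3 p1 p2 p3 q1 q2 q3 := by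
  intro h
  let p : Fin 3 → ℂ × ℂ := ![p1, p2, p3]
  let q : Fin 3 → ℂ × ℂ := ![q1, q2, q3]
  have hpq : ∀ (i : Fin 3) (t : ℂ), sd (x + t • v) (p i) = sd (y + t • u) (q i) := by
    intro i t
    obtain ⟨h1, h2, h3⟩ := h t
    fin_cases i
    exacts [h1, h2, h3]
  have hne : ∀ i j, i < j → sd (p i) (p j) ≠ sd (q i) (q j) := by
    intro i j hij
    fin_cases i <;> fin_cases j <;> first | exact absurd hij (by decide) | assumption
  simp only [sd, Prod.fst_add, Prod.snd_add, Prod.smul_fst, Prod.smul_snd, smul_eq_mul] at hpq hne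
  have hu' : u.1 ≠ 0 ∨ u.2 ≠ 0 := by
    by_contra! hc
    exact hu (Prod.ext hc.1 hc.2)
  have h0 : v.1 - u.1 ≠ 0 ∨ u.2 - v.2 ≠ 0 ∨ u.2 + v.2 ≠ 0 ∨ v.1 + u.1 ≠ 0 := by
    by_contra! hc
    obtain ⟨a, b, c, d⟩ := hc
    rcases hu' with hu | hu
    · exact hu (by linear_combination (d - a) / 2)
    · exact hu (by linear_combination (b + c) / 2)
  obtain ⟨i, j, hij, e⟩ := exists_isotropic_sub h0
    (by linear_combination (hpq 0 1 + hpq 0 (-1) - 2 * hpq 0 0) / 2)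
    (fun i => (x.1 - (p i).1) - (y.1 - (q i).1)) (fun i => (y.2 - (q i).2) - (x.2 - (p i).2))
    (fun i => (y.2 - (q i).2) + (x.2 - (p i).2)) (fun i => (x.1 - (p i).1) + (y.1 - (q i).1))
    (fun i => by linear_combination hpq i 0)
    (fun i => by linear_combination (hpq i 1 - hpq i (-1)) / 2)
  exact hne i j hij (by linear_combination e)

open Polynomial in
/-- An element of `ℂ[X]_L` is determined by its values at the points where `L` does not vanish. -/
lemma away_eq_zero_of_forall_lift {L : ℂ[X]} (hL : L ≠ 0) (k : Localization.Away L)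
    (h : ∀ (a : ℂ) (ha : IsUnit (evalRingHom a L)), IsLocalization.Away.lift L ha k = 0) :
    k = 0 := by
  obtain ⟨n, p, hp⟩ := IsLocalization.Away.surj L k
  have hpL : p * L = 0 := by
    refine Polynomial.funext fun a => ?_
    by_cases ha : L.eval a = 0
    · simp [ha]
    · have ha' : IsUnit (evalRingHom a L) := isUnit_iff_ne_zero.mpr (by simpa using ha)
      have := congrArg (IsLocalization.Away.lift L ha') hp
      rw [map_mul, h a ha', zero_mul, IsLocalization.Away.lift_eq] at this
      simp only [coe_evalRingHom] at this
      simp [← this]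
  have hp0 : p = 0 := (mul_eq_zero.mp hpL).resolve_right hL
  rw [hp0, map_zero] at hp
  exact (((IsLocalization.Away.algebraMap_isUnit L).pow n).mul_left_eq_zero).mp hp

open Polynomial in
lemma ringKrullDim_away_eq_one {L : ℂ[X]} (hL : L ≠ 0) :
    ringKrullDim (Localization.Away L) = 1 := by
  have hM : Submonoid.powers L ≤ nonZeroDivisors ℂ[X] :=
    powers_le_nonZeroDivisors_of_noZeroDivisors hL
  have : IsDomain (Localization.Away L) := IsLocalization.isDomain_localization hM
  have : IsPrincipalIdealRing (Localization.Away L) :=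
    ⟨fun J => by
      obtain ⟨g, hg⟩ := IsPrincipalIdealRing.principal (J.under ℂ[X])
      refine ⟨algebraMap _ _ g, ?_⟩
      rw [← IsLocalization.map_under (Submonoid.powers L) _ J, hg, Ideal.submodule_span_eq,
        Ideal.map_span, Set.image_singleton, Ideal.submodule_span_eq]⟩
  refine IsPrincipalIdealRing.ringKrullDim_eq_one _ fun hf => ?_
  obtain ⟨a, ha⟩ : ∃ a, L.eval a ≠ 0 := by
    by_contra! hc
    exact hL (Polynomial.funext (by simpa using hc))
  have ha' : IsUnit (evalRingHom a L) := isUnit_iff_ne_zero.mpr (by simpa using ha)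
  have hX : algebraMap ℂ[X] (Localization.Away L) (X - C a) ≠ 0 := by
    rw [Ne, map_eq_zero_iff _ (IsLocalization.injective _ hM)]
    exact X_sub_C_ne_zero a
  obtain ⟨b, hb⟩ := hf.mul_inv_cancel hX
  have := congrArg (IsLocalization.Away.lift L ha') hb
  rw [map_mul, IsLocalization.Away.lift_eq] at this
  simp at this

open Polynomial in
/-- A set parametrized by the curve `t L(s) + c(s) = 0`, with `L` and `c` coprime, is irreducible
of dimension one. -/
lemma irr_and_dim_of_parametrization (S : Set ((ℂ × ℂ) × (ℂ × ℂ))) {L c : ℂ[X]} (hL : L ≠ 0)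
    (hLc : IsCoprime L c) (z m n : Fin 4 → ℂ) (σ τ : MvPolynomial (Fin 4) ℂ)
    (hσ : ∀ s t : ℂ, MvPolynomial.eval (z + s • m + t • n) σ = s)
    (hτ : ∀ s t : ℂ, MvPolynomial.eval (z + s • m + t • n) τ = t)
    (hS : ∀ p, p ∈ S ↔ ∃ s t : ℂ, pt4 p = z + s • m + t • n ∧ t * L.eval s + c.eval s = 0) :
    IsIrr4 S ∧ dim4 S = 1 := by
  have hM : Submonoid.powers L ≤ nonZeroDivisors ℂ[X] :=
    powers_le_nonZeroDivisors_of_noZeroDivisors hL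
  have : IsDomain (Localization.Away L) := IsLocalization.isDomain_localization hM
  let ι : ℂ[X] →ₐ[ℂ] Localization.Away L := IsScalarTower.toAlgHom ℂ ℂ[X] (Localization.Away L)
  let w : Localization.Away L := IsLocalization.Away.invSelf L
  have hw : ι L * w = 1 := IsLocalization.Away.mul_invSelf L
  let T : Localization.Away L := -(ι c * w)
  let θ : MvPolynomial (Fin 4) ℂ →ₐ[ℂ] Localization.Away L :=
    MvPolynomial.aeval fun i => ι (C (z i) + C (m i) * X) + ι (C (n i)) * T
  have hev : ∀ (a : ℂ) (ha : IsUnit (evalRingHom a L)) (f : MvPolynomial (Fin 4) ℂ),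
      IsLocalization.Away.lift L ha (θ f) =
        MvPolynomial.eval (z + a • m + (-(c.eval a / L.eval a)) • n) f := by
    intro a ha f
    have hι : ∀ q, IsLocalization.Away.lift L ha (ι q) = q.eval a := fun q =>
      IsLocalization.Away.lift_eq L ha q
    have hwa : IsLocalization.Away.lift L ha w = (L.eval a)⁻¹ := by
      have := congrArg (IsLocalization.Away.lift L ha) hw
      rw [map_mul, hι, map_one] at this
      exact eq_inv_of_mul_eq_one_right this
    have hT : IsLocalization.Away.lift L ha T = -(c.eval a / L.eval a) := by
      simp only [T, map_neg, map_mul, hι, hwa, div_eq_mul_inv]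
    have : ((IsLocalization.Away.lift L ha : Localization.Away L →+* ℂ).comp θ.toRingHom) =
        MvPolynomial.eval (z + a • m + (-(c.eval a / L.eval a)) • n) := by
      refine MvPolynomial.ringHom_ext (fun r => ?_) (fun i => ?_)
      · have h1 : θ (MvPolynomial.C r) = ι (C r) := by
          simp only [θ, MvPolynomial.aeval_C]
          exact (ι.commutes r).symm
        simp [h1, hι]
      · have h1 : θ (MvPolynomial.X i) = ι (C (z i) + C (m i) * X) + ι (C (n i)) * T := by
          simp only [θ, MvPolynomial.aeval_X]
        simp only [RingHom.comp_apply, AlgHom.toRingHom_eq_coe, RingHom.coe_coe, h1, map_add,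
          map_mul, hι, hT]
        simp
        ring
    exact congrArg (fun g => g f) this
  have hker : vanIdeal4 S = RingHom.ker θ := by
    ext f
    rw [RingHom.mem_ker]
    constructor
    · intro hf
      refine away_eq_zero_of_forall_lift hL _ fun a ha => ?_
      rw [hev]
      have ha' : L.eval a ≠ 0 := by simpa using ha.ne_zero
      let v := z + a • m + (-(c.eval a / L.eval a)) • n
      have hv : pt4 ((v 0, v 1), (v 2, v 3)) = v := by
        ext i
        fin_cases i <;> rfl
      have := hf ((v 0, v 1), (v 2, v 3)) ((hS _).mpr ⟨a, _, hv, by field_simp; ring⟩)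
      rwa [hv] at this
    · intro hf p hp
      obtain ⟨s, t, hst, h0⟩ := (hS p).mp hp
      have hs : L.eval s ≠ 0 := by
        intro h
        obtain ⟨u, v, huv⟩ := hLc
        have := congrArg (eval s) huv
        rw [h, mul_zero, zero_add] at h0
        simp [h, h0] at this
      have ht : t = -(c.eval s / L.eval s) := by
        field_simp
        linear_combination h0
      have := hev s (isUnit_iff_ne_zero.mpr (by simpa using hs)) f
      rw [hf, map_zero] at this
      rw [hst, ht, ← this]
  have hsurj : Function.Surjective θ := by
    have hX : θ σ = ι X := by
      rw [← sub_eq_zero]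
      refine away_eq_zero_of_forall_lift hL _ fun a ha => ?_
      rw [map_sub, hev, hσ]
      simp [ι, IsLocalization.Away.lift_eq]
    have hT : θ τ = T := by
      rw [← sub_eq_zero]
      refine away_eq_zero_of_forall_lift hL _ fun a ha => ?_
      have hι : ∀ q, IsLocalization.Away.lift L ha (ι q) = q.eval a := fun q =>
        IsLocalization.Away.lift_eq L ha q
      have := congrArg (IsLocalization.Away.lift L ha) hw
      rw [map_mul, hι, map_one] at this
      rw [map_sub, hev, hτ]
      simp only [T, map_neg, map_mul, hι, eq_inv_of_mul_eq_one_right this, div_eq_mul_inv, sub_self]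
    have hι : ∀ q, ι q ∈ θ.range := by
      intro q
      have : θ (aeval σ q) = ι q := by
        rw [← aeval_algHom_apply, hX, aeval_algHom_apply, aeval_X_left_apply]
      exact ⟨_, this⟩
    have hwm : w ∈ θ.range := by
      obtain ⟨u, v, huv⟩ := hLc
      have h1 : ι u * ι L + ι v * ι c = 1 := by rw [← map_mul, ← map_mul, ← map_add, huv, map_one]
      have h2 : w = ι u - ι v * T := by
        simp only [T]
        linear_combination (-w) * h1 + ι u * hw
      rw [h2]
      exact sub_mem (hι u) (mul_mem (hι v) ⟨τ, hT⟩)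
    intro k
    obtain ⟨N, p, hp⟩ := IsLocalization.Away.surj L k
    have hk : k = ι p * w ^ N := by
      have h1 : ι p = k * ι L ^ N := hp.symm
      rw [h1, mul_assoc, ← mul_pow, hw, one_pow, mul_one]
    rw [hk]
    exact mul_mem (hι p) (pow_mem hwm N)
  constructor
  · rw [IsIrr4, hker]
    exact RingHom.ker_isPrime θ
  · have e : (MvPolynomial (Fin 4) ℂ ⧸ RingHom.ker θ) ≃ₐ[ℂ] Localization.Away L :=
      Ideal.quotientKerAlgEquivOfSurjective hsurj
    rw [dim4, hker]
    exact (ringKrullDim_eq_of_ringEquiv e.toRingEquiv).trans (ringKrullDim_away_eq_one hL)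

/-- A binary quadratic form over `ℂ` has an isotropic vector, which is part of a unimodular basis. -/
lemma exists_isotropic_unimodular (a b c : ℂ) :
    ∃ e f : ℂ × ℂ, a * e.1 ^ 2 + b * e.1 * e.2 + c * e.2 ^ 2 = 0 ∧ e.1 * f.2 - e.2 * f.1 = 1 := by
  by_cases ha : a = 0
  · exact ⟨(1, 0), (0, 1), by simp [ha], by simp⟩
  · obtain ⟨r, hr⟩ := exists_quadratic_eq_zero (b := b) (c := c) ha
      (by obtain ⟨s, hs⟩ := IsAlgClosed.exists_pow_nat_eq (discrim a b c) two_pos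
          exact ⟨s, by rw [← hs, sq]⟩)
    exact ⟨(r, 1), (-1, 0), by simp only; linear_combination hr, by simp⟩

/-- A quadratic polynomial function without roots is constant. -/
lemma quadratic_coeff_eq_zero_of_forall_ne_zero {γ δ ε : ℂ}
    (h : ∀ s, γ * s ^ 2 + δ * s + ε ≠ 0) : γ = 0 ∧ δ = 0 := by
  have hγ : γ = 0 := by
    by_contra hγ
    obtain ⟨r, hr⟩ := exists_quadratic_eq_zero (b := δ) (c := ε) hγ
      (by obtain ⟨s, hs⟩ := IsAlgClosed.exists_pow_nat_eq (discrim γ δ ε) two_pos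
          exact ⟨s, by rw [← hs, sq]⟩)
    exact h r (by linear_combination hr)
  refine ⟨hγ, ?_⟩
  by_contra hδ
  exact h (-ε / δ) (by rw [hγ]; field_simp; ring)

/-- Two linearly independent `P, P'` allow the linear equations of `Γ` to be solved for the first
point. -/
lemma exists_affine_solution {P P' : ℂ × ℂ} (hD : P.1 * P'.2 - P.2 * P'.1 ≠ 0) (R R' : ℂ × ℂ)
    (k k' : ℂ) :
    ∃ a11 a12 a21 a22 b1 b2 : ℂ,
      (a11 * P.1 + a21 * P.2 = R.1 ∧ a12 * P.1 + a22 * P.2 = R.2) ∧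
      ∀ X Y : ℂ × ℂ, (X.1 * P.1 + X.2 * P.2 = k + (Y.1 * R.1 + Y.2 * R.2) ∧
        X.1 * P'.1 + X.2 * P'.2 = k' + (Y.1 * R'.1 + Y.2 * R'.2)) ↔
        X.1 = a11 * Y.1 + a12 * Y.2 + b1 ∧ X.2 = a21 * Y.1 + a22 * Y.2 + b2 := by
  set D := P.1 * P'.2 - P.2 * P'.1 with hDdef
  refine ⟨(R.1 * P'.2 - R'.1 * P.2) / D, (R.2 * P'.2 - R'.2 * P.2) / D,
    (R'.1 * P.1 - R.1 * P'.1) / D, (R'.2 * P.1 - R.2 * P'.1) / D,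
    (k * P'.2 - k' * P.2) / D, (k' * P.1 - k * P'.1) / D, ⟨?_, ?_⟩, fun X Y => ⟨?_, ?_⟩⟩
  · field_simp
    rw [hDdef]
    ring
  · field_simp
    rw [hDdef]
    ring
  · rintro ⟨h1, h2⟩
    constructor
    · field_simp
      linear_combination P'.2 * h1 - P.2 * h2 + X.1 * hDdef
    · field_simp
      linear_combination P.1 * h2 - P'.1 * h1 + X.2 * hDdef
  · rintro ⟨h1, h2⟩
    rw [h1, h2]
    constructor
    · field_simp
      rw [hDdef]
      ring
    · field_simp
      rw [hDdef]
      ring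

/-- The transpose of a linear map preserving the form `x² + y²` preserves it too. -/
lemma transpose_preserves_sum_sq {a11 a12 a21 a22 : ℂ}
    (h : ∀ x y : ℂ, (a11 * x + a12 * y) ^ 2 + (a21 * x + a22 * y) ^ 2 = x ^ 2 + y ^ 2) (x y : ℂ) :
    (a11 * x + a21 * y) ^ 2 + (a12 * x + a22 * y) ^ 2 = x ^ 2 + y ^ 2 := by
  have h1 : a11 * a11 + a21 * a21 = 1 := by linear_combination h 1 0
  have h2 : a11 * a12 + a21 * a22 = 0 := by linear_combination (h 1 1 - h 1 0 - h 0 1) / 2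
  have h3 : a12 * a12 + a22 * a22 = 1 := by linear_combination h 0 1
  have hmul : !![a11, a21; a12, a22] * !![a11, a12; a21, a22] =
      (1 : Matrix (Fin 2) (Fin 2) ℂ) := by
    rw [Matrix.mul_fin_two, Matrix.one_fin_two, h1, h2, h3, mul_comm a12, mul_comm a22, h2]
  have hmul' := mul_eq_one_comm.mp hmul
  rw [Matrix.mul_fin_two, Matrix.one_fin_two] at hmul'
  have e1 : a11 * a11 + a12 * a12 = 1 := congrFun (congrFun hmul' 0) 0
  have e2 : a11 * a21 + a12 * a22 = 0 := congrFun (congrFun hmul' 0) 1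
  have e3 : a21 * a21 + a22 * a22 = 1 := congrFun (congrFun hmul' 1) 1
  linear_combination x ^ 2 * e1 + 2 * x * y * e2 + y ^ 2 * e3

/-- If `p₁, p₂, p₃` are not collinear and
`d(p_v, p_w) ≠ d(q_v, q_w)` for all distinct `v, w ∈ {1, 2, 3}`, then `Γ` is
irreducible of dimension 1. -/
theorem gamma_three_points_no_equal_lengths (p1 p2 p3 q1 q2 q3 : ℂ × ℂ)
    (hcol : LinearIndependent ℂ ![p2 - p1, p3 - p1])
    (h12 : sd p1 p2 ≠ sd q1 q2)
    (h13 : sd p1 p3 ≠ sd q1 q3)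
    (h23 : sd p2 p3 ≠ sd q2 q3) :
    IsIrr4 (Gamma3 p1 p2 p3 q1 q2 q3) ∧
    dim4 (Gamma3 p1 p2 p3 q1 q2 q3) = 1 := by
  have hline := not_line_subset_Gamma3 h12 h13 h23
  have hD : (p2 - p1).1 * (p3 - p1).2 - (p2 - p1).2 * (p3 - p1).1 ≠ 0 := by
    intro hD
    rw [LinearIndependent.pair_iff] at hcol
    have h1 := hcol (p3 - p1).1 (-(p2 - p1).1)
      (Prod.ext (by simp; ring) (by simp at hD ⊢; linear_combination -hD))
    have h2 := hcol (p3 - p1).2 (-(p2 - p1).2)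
      (Prod.ext (by simp at hD ⊢; linear_combination hD) (by simp; ring))
    have := hcol 0 1 (by
      rw [zero_smul, one_smul, zero_add]
      exact Prod.ext h1.1 h2.1)
    exact one_ne_zero this.2
  let k : ℂ := (sd p1 p2 - sd q1 q2) / 2
  let k' : ℂ := (sd p1 p3 - sd q1 q3) / 2
  obtain ⟨a11, a12, a21, a22, b1, b2, ⟨hA1, hA2⟩, hsol⟩ :=
    exists_affine_solution hD (q2 - q1) (q3 - q1) k k'
  have hmem : ∀ x y : ℂ × ℂ, (x, y) ∈ Gamma3 p1 p2 p3 q1 q2 q3 ↔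
      sd x p1 = sd y q1 ∧ (x - p1).1 = a11 * (y - q1).1 + a12 * (y - q1).2 + b1 ∧
        (x - p1).2 = a21 * (y - q1).1 + a22 * (y - q1).2 + b2 := by
    intro x y
    rw [← hsol]
    simp only [Gamma3, Set.mem_ofPred_eq, sd, k, k', Prod.fst_sub, Prod.snd_sub]
    constructor
    · rintro ⟨h1, h2, h3⟩
      exact ⟨h1, by linear_combination (h1 - h2) / 2, by linear_combination (h1 - h3) / 2⟩
    · rintro ⟨h1, h2, h3⟩
      exact ⟨h1, by linear_combination h1 - 2 * h2, by linear_combination h1 - 2 * h3⟩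
  clear hsol
  obtain ⟨e, f, he, hef⟩ := exists_isotropic_unimodular (a11 ^ 2 + a21 ^ 2 - 1)
    (2 * (a11 * a12 + a21 * a22)) (a12 ^ 2 + a22 ^ 2 - 1)
  let v : ℂ × ℂ := (a11 * e.1 + a12 * e.2, a21 * e.1 + a22 * e.2)
  let u : ℂ × ℂ := (a11 * f.1 + a12 * f.2, a21 * f.1 + a22 * f.2)
  let x0 : ℂ × ℂ := (p1.1 + b1, p1.2 + b2)
  let α : ℂ := 2 * (u.1 * v.1 + u.2 * v.2 - e.1 * f.1 - e.2 * f.2)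
  let β : ℂ := 2 * (b1 * v.1 + b2 * v.2)
  let γ : ℂ := u.1 ^ 2 + u.2 ^ 2 - f.1 ^ 2 - f.2 ^ 2
  let δ : ℂ := 2 * (b1 * u.1 + b2 * u.2)
  let ε : ℂ := b1 ^ 2 + b2 ^ 2
  have hpar : ∀ s t : ℂ, (x0 + s • u + t • v, q1 + s • f + t • e) ∈ Gamma3 p1 p2 p3 q1 q2 q3 ↔
      t * (α * s + β) + (γ * s ^ 2 + δ * s + ε) = 0 := by
    intro s t
    rw [hmem]
    simp only [sd, x0, u, v, α, β, γ, δ, ε, Prod.fst_add, Prod.snd_add, Prod.fst_sub, Prod.snd_sub,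
      Prod.smul_fst, Prod.smul_snd, smul_eq_mul]
    constructor
    · rintro ⟨h, -, -⟩
      linear_combination h - t ^ 2 * he
    · intro h
      exact ⟨by linear_combination h + t ^ 2 * he, by ring, by ring⟩
  have he0 : e ≠ 0 := by
    rintro rfl
    simp at hef
  have hroot : ∀ s, α * s + β = 0 → γ * s ^ 2 + δ * s + ε ≠ 0 := by
    intro s h1 h2
    exact hline (x0 + s • u) v (q1 + s • f) e he0 fun t => by
      rw [hpar, h1, h2, mul_zero, zero_add]
  have hαβ : ¬ (α = 0 ∧ β = 0) := by
    rintro ⟨hα, hβ⟩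
    obtain ⟨hγ, -⟩ := quadratic_coeff_eq_zero_of_forall_ne_zero fun s => hroot s (by rw [hα, hβ]; ring)
    have hO : ∀ x y : ℂ, (a11 * x + a12 * y) ^ 2 + (a21 * x + a22 * y) ^ 2 = x ^ 2 + y ^ 2 := by
      intro x y
      have hx : x = (x * f.2 - y * f.1) * e.1 + (y * e.1 - x * e.2) * f.1 := by
        linear_combination -x * hef
      have hy : y = (x * f.2 - y * f.1) * e.2 + (y * e.1 - x * e.2) * f.2 := by
        linear_combination -y * hef
      generalize x * f.2 - y * f.1 = t at hx hy
      generalize y * e.1 - x * e.2 = s at hx hy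
      subst hx hy
      simp only [α, γ, u, v] at hα hγ
      linear_combination t ^ 2 * he + s * t * hα + s ^ 2 * hγ
    have := transpose_preserves_sum_sq hO (p2 - p1).1 (p2 - p1).2
    rw [hA1, hA2] at this
    apply h12
    simp only [Prod.fst_sub, Prod.snd_sub] at this
    simp only [sd]
    linear_combination -this
  let L : Polynomial ℂ := .C α * .X + .C β
  let c : Polynomial ℂ := .C γ * .X ^ 2 + .C δ * .X + .C ε
  have hL : L ≠ 0 := by
    intro h
    refine hαβ ⟨?_, ?_⟩
    · simpa [L] using congrArg (fun p => p.coeff 1) h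
    · simpa [L] using congrArg (fun p => p.coeff 0) h
  have hcop : IsCoprime L c := by
    rw [Polynomial.isCoprime_iff_aeval_ne_zero_of_isAlgClosed ℂ ℂ]
    intro a
    by_cases h : α * a + β = 0
    · exact Or.inr (by simpa [c] using hroot a h)
    · exact Or.inl (by simpa [L] using h)
  refine irr_and_dim_of_parametrization _ hL hcop ![x0.1, x0.2, q1.1, q1.2]
    ![u.1, u.2, f.1, f.2] ![v.1, v.2, e.1, e.2]
    (MvPolynomial.C e.1 * (MvPolynomial.X 3 - MvPolynomial.C q1.2) -
      MvPolynomial.C e.2 * (MvPolynomial.X 2 - MvPolynomial.C q1.1))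
    (MvPolynomial.C f.2 * (MvPolynomial.X 2 - MvPolynomial.C q1.1) -
      MvPolynomial.C f.1 * (MvPolynomial.X 3 - MvPolynomial.C q1.2)) ?_ ?_ ?_
  · intro s t
    simp
    linear_combination s * hef
  · intro s t
    simp
    linear_combination t * hef
  · rintro ⟨x, y⟩
    have hpt : ∀ s t : ℂ, pt4 (x, y) = ![x0.1, x0.2, q1.1, q1.2] + s • ![u.1, u.2, f.1, f.2] +
        t • ![v.1, v.2, e.1, e.2] ↔ (x, y) = (x0 + s • u + t • v, q1 + s • f + t • e) := by
      intro s t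
      simp [pt4, Prod.ext_iff, and_assoc]
    simp only [hpt]
    constructor
    · intro h
      let s := (y - q1).2 * e.1 - (y - q1).1 * e.2
      let t := (y - q1).1 * f.2 - (y - q1).2 * f.1
      have hst : (x, y) = (x0 + s • u + t • v, q1 + s • f + t • e) := by
        obtain ⟨-, h1, h2⟩ := (hmem x y).mp h
        have hy1 : (y - q1).1 = s * f.1 + t * e.1 := by
          simp only [s, t]
          linear_combination -(y - q1).1 * hef
        have hy2 : (y - q1).2 = s * f.2 + t * e.2 := by
          simp only [s, t]
          linear_combination -(y - q1).2 * hef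
        generalize s = s at *
        generalize t = t at *
        rw [hy1, hy2] at h1 h2
        simp only [Prod.fst_sub, Prod.snd_sub] at hy1 hy2 h1 h2
        simp only [Prod.ext_iff, Prod.fst_add, Prod.snd_add, Prod.smul_fst, Prod.smul_snd,
          smul_eq_mul, x0, u, v]
        exact ⟨⟨by linear_combination h1, by linear_combination h2⟩,
          by linear_combination hy1, by linear_combination hy2⟩
      refine ⟨s, t, hst, ?_⟩
      rw [hst, hpar] at h
      simpa [L, c] using h
    · rintro ⟨s, t, hst, h⟩
      rw [hst, hpar]
      simpa [L, c] using h
end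

section
/- (Geiringer–Laman) A graph G=(V,E) is minimally rigid if and only if it is tight. Here G is minimally rigid if there exist a positive integer n and a nonzero polynomial F in the variables (x_e)_{e∈E} over ℂ such that for every λ ∈ ℂ^E with F(λ) ≠ 0, the set E_G⁻¹(λ) of λ-compatible realizations has exactly n equivalence classes under the relation r ∼ s :⟺ there exists t ∈ T with s = t∘r (i.e. |E_G⁻¹(λ)/T| = n for general λ). -/
open scoped Classical

noncomputable section

variable {α : Type*} [DecidableEq α]

/-- `(V, E)` is a finite simple undirected graph: edges are non-diagonal
unordered pairs with both endpoints in `V`. -/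
def IsGraph (V : Finset α) (E : Finset (Sym2 α)) : Prop :=
  ∀ e ∈ E, ¬ e.IsDiag ∧ ∀ v ∈ e, v ∈ V

/-- `(V', E')` is a subgraph of `(V, E)`. -/
def IsSubgraph (V' : Finset α) (E' : Finset (Sym2 α))
    (V : Finset α) (E : Finset (Sym2 α)) : Prop :=
  IsGraph V' E' ∧ V' ⊆ V ∧ E' ⊆ E

/-- A graph is sparse if every subgraph `(V', E')` with `|V'| ≥ 2`
satisfies `|E'| ≤ 2|V'| - 3`. -/
def IsSparse (V : Finset α) (E : Finset (Sym2 α)) : Prop :=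
  IsGraph V E ∧ ∀ V' E', IsSubgraph V' E' V E → 2 ≤ V'.card →
    (E'.card : ℤ) ≤ 2 * V'.card - 3

/-- A graph is tight if it is sparse and `|V| = 1` or `|E| = 2|V| - 3`. -/
def IsTight (V : Finset α) (E : Finset (Sym2 α)) : Prop :=
  IsSparse V E ∧ (V.card = 1 ∨ (E.card : ℤ) = 2 * V.card - 3)

/-- `(V', E')` is a max-tight subgraph of `(V, E)`. -/
def IsMaxTight (V' : Finset α) (E' : Finset (Sym2 α))
    (V : Finset α) (E : Finset (Sym2 α)) : Prop :=
  IsSubgraph V' E' V E ∧ IsTight V' E' ∧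
    ∀ V'' E'', IsSubgraph V'' E'' V E → IsTight V'' E'' →
      V' ⊆ V'' → E' ⊆ E'' → V' = V'' ∧ E' = E''

/-- `{(Vi i, Ei i)}_{i ∈ I}` is a max-tight decomposition of `(V, E)`. -/
def IsMaxTightDecomp {I : Type*} (V : Finset α) (E : Finset (Sym2 α))
    (Vi : I → Finset α) (Ei : I → Finset (Sym2 α)) : Prop :=
  (∀ i, IsMaxTight (Vi i) (Ei i) V E) ∧
  (∀ v ∈ V, ∃ i, v ∈ Vi i) ∧
  (∀ e ∈ E, ∃ i, e ∈ Ei i) ∧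
  (∀ i j, i ≠ j → ∀ e, ¬ (e ∈ Ei i ∧ e ∈ Ei j))

/-- Extend a realization of `V` to all of `α` (by zero off `V`). -/
def extendR (V : Finset α) (r : ↥V → ℂ × ℂ) : α → ℂ × ℂ :=
  fun a => if h : a ∈ V then r ⟨a, h⟩ else 0

/-- The squared distance along an unordered pair of vertices. -/
def edgeVal (r : α → ℂ × ℂ) : Sym2 α → ℂ :=
  Sym2.lift ⟨fun u v => sd (r u) (r v), fun u v => by simp only [sd]; ring⟩

/-- The edge map `E_G : (ℂ²)^V → ℂ^E`. -/
def edgeMap (V : Finset α) (E : Finset (Sym2 α)) (r : ↥V → ℂ × ℂ) :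
    {e // e ∈ E} → ℂ :=
  fun e => edgeVal (extendR V r) e.1

/-- The set `E_G⁻¹(λ)` of `λ`-compatible realizations. -/
def fiber (V : Finset α) (E : Finset (Sym2 α)) (lam : {e // e ∈ E} → ℂ) :
    Set (↥V → ℂ × ℂ) :=
  {r | edgeMap V E r = lam}

/-- The set of equivalence classes of `S` under `r ∼ s ↔ ∃ t ∈ T, s = t ∘ r`. -/
def TClasses {β : Type*} (S : Set (β → ℂ × ℂ)) : Set (Set (β → ℂ × ℂ)) :=
  {C | ∃ r ∈ S, C = {s | s ∈ S ∧ ∃ t, IsTransf t ∧ s = fun v => t (r v)}}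

/-- The coordinates of a realization, as a point of affine space with
coordinate ring `ℂ[x_v, y_v : v ∈ β]`. -/
def coords {β : Type*} (r : β → ℂ × ℂ) : β × Fin 2 → ℂ :=
  fun p => if p.2 = 0 then (r p.1).1 else (r p.1).2

/-- The vanishing ideal of a set of realizations in `ℂ[x_v, y_v : v ∈ β]`. -/
def vanishingIdeal {β : Type*} (S : Set (β → ℂ × ℂ)) :
    Ideal (MvPolynomial (β × Fin 2) ℂ) where
  carrier := {f | ∀ r ∈ S, MvPolynomial.eval (coords r) f = 0}
  add_mem' := by
    intro a b ha hb r hr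
    simp only [Set.mem_setOf_eq] at ha hb ⊢
    simp [map_add, ha r hr, hb r hr]
  zero_mem' := by intro r hr; simp
  smul_mem' := by
    intro c f hf r hr
    simp only [Set.mem_setOf_eq] at hf ⊢
    simp [smul_eq_mul, map_mul, hf r hr]

end

/-- The elements of `L` that some power of `F` multiplies into the subalgebra `C`. -/
def Subalgebra.awayClosure {A L : Type*} [CommRing A] [CommRing L] [Algebra A L]
    (C : Subalgebra A L) (F : A) : Subalgebra A L where
  carrier := {d | ∃ k : ℕ, F ^ k • d ∈ C}
  mul_mem' := by
    rintro x y ⟨k, hk⟩ ⟨l, hl⟩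
    refine ⟨k + l, ?_⟩
    have := C.mul_mem hk hl
    rwa [smul_mul_smul_comm, ← pow_add] at this
  add_mem' := by
    rintro x y ⟨k, hk⟩ ⟨l, hl⟩
    refine ⟨k + l, ?_⟩
    have h := C.add_mem (C.smul_mem hk (F ^ l)) (C.smul_mem hl (F ^ k))
    rwa [smul_smul, smul_smul, ← pow_add, ← pow_add, add_comm l k, ← smul_add] at h
  algebraMap_mem' a := ⟨0, by simp⟩

theorem Subalgebra.le_awayClosure {A L : Type*} [CommRing A] [CommRing L] [Algebra A L]
    (C : Subalgebra A L) (F : A) : C ≤ C.awayClosure F :=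
  fun x hx => ⟨0, by simpa using hx⟩

theorem Subalgebra.awayClosure_le {A L : Type*} [CommRing A] [CommRing L] [Algebra A L]
    {C D : Subalgebra A L} {F : A} (h : C ≤ D.awayClosure F) :
    C.awayClosure F ≤ D.awayClosure F := by
  rintro x ⟨k, hk⟩
  obtain ⟨l, hl⟩ := h hk
  exact ⟨l + k, by rwa [pow_add, mul_smul]⟩

theorem Subalgebra.card_algHom_awayClosure {A L k : Type*} [CommRing A] [Field L] [Algebra A L]
    [Field k] [Algebra A k] (C : Subalgebra A L) (F : A) (hFL : algebraMap A L F ≠ 0)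
    (hFk : algebraMap A k F ≠ 0) :
    Nat.card (C.awayClosure F →ₐ[A] k) = Nat.card (C →ₐ[A] k) := by
  have hle := C.le_awayClosure F
  refine Nat.card_congr (Equiv.ofBijective
    (fun ψ : C.awayClosure F →ₐ[A] k => ψ.comp (Subalgebra.inclusion hle)) ⟨?_, ?_⟩)
  · intro ψ₁ ψ₂ h
    ext ⟨d, m, hm⟩
    have h' := DFunLike.congr_fun h ⟨_, hm⟩
    have e : ∀ ψ : C.awayClosure F →ₐ[A] k, (ψ.comp (Subalgebra.inclusion hle)) ⟨_, hm⟩ =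
        algebraMap A k F ^ m * ψ ⟨d, m, hm⟩ := by
      intro ψ
      have : Subalgebra.inclusion hle ⟨_, hm⟩ = F ^ m • (⟨d, m, hm⟩ : C.awayClosure F) := by
        ext; simp
      rw [AlgHom.comp_apply, this, map_smul, Algebra.smul_def, map_pow]
    simp only [e] at h'
    exact mul_left_cancel₀ (pow_ne_zero m hFk) h'
  · intro ψ
    let _ : Algebra C (C.awayClosure F) := (Subalgebra.inclusion hle).toRingHom.toAlgebra
    have hst : IsScalarTower A C (C.awayClosure F) := IsScalarTower.of_algebraMap_eq fun x => rfl
    have hinj : Function.Injective (algebraMap C (C.awayClosure F)) :=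
      Subalgebra.inclusion_injective hle
    have hloc : IsLocalization.Away (algebraMap A C F) (C.awayClosure F) := by
      refine IsLocalization.Away.mk _ ?_ ?_ ?_
      · have hmem : (algebraMap A L F)⁻¹ ∈ C.awayClosure F :=
          ⟨1, by rw [pow_one, Algebra.smul_def, mul_inv_cancel₀ hFL]; exact C.one_mem⟩
        refine IsUnit.of_mul_eq_one ⟨_, hmem⟩ ?_
        ext
        exact mul_inv_cancel₀ hFL
      · rintro ⟨d, m, hm⟩
        refine ⟨m, ⟨_, hm⟩, ?_⟩
        ext
        change d * (algebraMap A L F) ^ m = F ^ m • d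
        rw [Algebra.smul_def, map_pow, mul_comm]
      · intro a b h
        exact ⟨0, by rw [hinj h]⟩
    have hu : ∀ y : Submonoid.powers (algebraMap A C F), IsUnit (ψ y) := by
      rintro ⟨_, m, rfl⟩
      simpa using fun h => absurd h hFk
    refine ⟨IsLocalization.liftAlgHom (M := Submonoid.powers (algebraMap A C F)) (f := ψ) hu, ?_⟩
    refine AlgHom.ext fun c => ?_
    have := IsLocalization.lift_eq (M := Submonoid.powers (algebraMap A C F))
      (S := C.awayClosure F) (g := (ψ : C →+* k)) hu c
    exact this

open Polynomial in
theorem exists_smul_mem_adjoin_of_adjoin_eq_top {A K L : Type*} [CommRing A] [IsDomain A] [Field K]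
    [Algebra A K] [IsFractionRing A K] [Field L] [Algebra K L] [Algebra A L] [IsScalarTower A K L]
    {θ : L} (hθ : Algebra.adjoin K {θ} = ⊤) (d : L) :
    ∃ a : A, a ≠ 0 ∧ a • d ∈ Algebra.adjoin A {θ} := by
  have hd : d ∈ Algebra.adjoin K {θ} := hθ ▸ Algebra.mem_top
  rw [Algebra.adjoin_singleton_eq_range_aeval] at hd
  obtain ⟨q, rfl⟩ := hd
  obtain ⟨b, hb, h⟩ := IsLocalization.integerNormalization_spec (nonZeroDivisors A) q
  refine ⟨b, nonZeroDivisors.ne_zero hb, ?_⟩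
  have : b • aeval θ q = aeval θ (IsLocalization.integerNormalization (nonZeroDivisors A) q) := by
    rw [← aeval_map_algebraMap K θ (IsLocalization.integerNormalization _ q), h,
      AlgHom.map_smul_of_tower]
  change b • aeval θ q ∈ _
  rw [this]
  exact aeval_mem_adjoin_singleton A θ

open Polynomial in
theorem exists_separable_map_of_separable {A K : Type*} [CommRing A] [IsDomain A] [Field K]
    [Algebra A K] [IsFractionRing A K] {P : A[X]} (hP : (P.map (algebraMap A K)).Separable) :
    ∃ D : A, D ≠ 0 ∧ ∀ {k : Type*} [Field k] (φ : A →+* k), φ D ≠ 0 → (P.map φ).Separable := by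
  obtain ⟨u, v, huv⟩ := hP
  obtain ⟨b, hb, hu⟩ := IsLocalization.integerNormalization_spec (nonZeroDivisors A) u
  obtain ⟨c, hc, hv⟩ := IsLocalization.integerNormalization_spec (nonZeroDivisors A) v
  have hinj := IsFractionRing.injective A K
  set u' := IsLocalization.integerNormalization (nonZeroDivisors A) u
  set v' := IsLocalization.integerNormalization (nonZeroDivisors A) v
  have key : C c * u' * P + C b * v' * derivative P = C (b * c) := by
    apply map_injective _ hinj
    have hs : ∀ (a : A) (w : K[X]), a • w = C (algebraMap A K a) * w := fun a w => by
      rw [← algebraMap_smul K a w, smul_eq_C_mul]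
    simp only [Polynomial.map_add, Polynomial.map_mul, hu, hv, map_C, ← derivative_map, hs, map_mul]
    linear_combination C (algebraMap A K b) * C (algebraMap A K c) * huv
  refine ⟨b * c, mul_ne_zero (nonZeroDivisors.ne_zero hb) (nonZeroDivisors.ne_zero hc), ?_⟩
  intro k _ φ hφ
  have h2 := congrArg (Polynomial.map φ) key
  simp only [Polynomial.map_add, Polynomial.map_mul, map_C, ← derivative_map] at h2
  refine ⟨C (φ (b * c))⁻¹ * (C (φ c) * u'.map φ), C (φ (b * c))⁻¹ * (C (φ b) * v'.map φ), ?_⟩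
  have h3 : (C (φ (b * c))⁻¹ : k[X]) * C (φ (b * c)) = 1 := by
    rw [← C_mul, inv_mul_cancel₀ hφ, C_1]
  linear_combination C (φ (b * c))⁻¹ * h2 + h3

open Polynomial in
theorem card_algHom_adjoin_singleton {A L k : Type*} [CommRing A] [IsDomain A]
    [IsIntegrallyClosed A] [Field L] [Algebra A L] [Module.IsTorsionFree A L] [Field k]
    [IsAlgClosed k] [Algebra A k] {θ : L} (hθ : IsIntegral A θ)
    (hsep : ((minpoly A θ).map (algebraMap A k)).Separable) :
    Nat.card (Algebra.adjoin A {θ} →ₐ[A] k) = (minpoly A θ).natDegree := by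
  rw [Nat.card_congr (Algebra.adjoin.powerBasis' hθ).liftEquiv]
  have hm := minpoly.monic hθ
  rw [← Algebra.adjoin.powerBasis'_minpoly_gen hθ, ← hm.natDegree_map (algebraMap A k),
    ← card_rootSet_eq_natDegree (K := k) hsep (IsAlgClosed.splits _), ← Nat.card_eq_fintype_card]
  refine Nat.card_congr (Equiv.subtypeEquivRight fun y => ?_)
  rw [mem_rootSet_of_ne hsep.ne_zero, aeval_def, aeval_def, eval₂_map]
  rfl

theorem exists_card_algHom_eq {A B : Type*} [CommRing A] [IsDomain A] [IsIntegrallyClosed A]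
    [CharZero A] [CommRing B] [IsDomain B] [Algebra A B] [FaithfulSMul A B] [Algebra.FiniteType A B]
    [Algebra.IsAlgebraic A B] (k : Type*) [Field k] [IsAlgClosed k] :
    ∃ n : ℕ, 0 < n ∧ ∃ F : A, F ≠ 0 ∧ ∀ [Algebra A k], algebraMap A k F ≠ 0 →
      Nat.card (B →ₐ[A] k) = n := by
  let K := FractionRing A
  let L := FractionRing B
  let _ : Algebra K L := FractionRing.liftAlgebra A L
  have : CharZero K := charZero_of_injective_algebraMap (IsFractionRing.injective A K)
  have : Algebra.IsAlgebraic A L := (IsFractionRing.isAlgebraic_iff' A B L).mp inferInstance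
  have : Algebra.IsAlgebraic K L := (IsFractionRing.comap_isAlgebraic_iff (A := A)).mp this
  have : Algebra.EssFiniteType B L := .of_isLocalization _ (nonZeroDivisors B)
  have : Algebra.EssFiniteType A L := .comp A B L
  have : Algebra.EssFiniteType K L := .of_comp A K L
  have : FiniteDimensional K L := Algebra.finite_of_essFiniteType_of_isAlgebraic
  obtain ⟨θ₀, hθ₀⟩ := Field.exists_primitive_element K L
  obtain ⟨y, hy, hint⟩ := (Algebra.IsAlgebraic.isAlgebraic (R := A) θ₀).exists_integral_multiple
  set θ : L := y • θ₀ with hθdef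
  have hθ : Algebra.adjoin K {θ} = ⊤ := by
    rw [eq_top_iff, ← Algebra.adjoin_eq_top_of_primitive_element
      (Algebra.IsIntegral.isIntegral θ₀).isAlgebraic hθ₀, Algebra.adjoin_le_iff,
      Set.singleton_subset_iff]
    have hyK : algebraMap A K y ≠ 0 :=
      (map_ne_zero_iff _ (IsFractionRing.injective A K)).mpr hy
    have : θ₀ = (algebraMap A K y)⁻¹ • θ := by
      rw [hθdef, ← algebraMap_smul K y θ₀, smul_smul, inv_mul_cancel₀ hyK, one_smul]
    rw [this]
    exact Subalgebra.smul_mem _ (Algebra.self_mem_adjoin_singleton K θ) _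
  let R : Subalgebra A L := (IsScalarTower.toAlgHom A B L).range
  let C : Subalgebra A L := Algebra.adjoin A {θ}
  obtain ⟨T, hT⟩ := (Algebra.FiniteType.out : (⊤ : Subalgebra A B).FG)
  choose a ha0 haC using fun d : L => exists_smul_mem_adjoin_of_adjoin_eq_top (A := A) hθ d
  obtain ⟨F₂, hF₂0, hF₂⟩ : ∃ c : A, c ≠ 0 ∧ c • θ ∈ R := by
    obtain ⟨b, s, hs, hbs⟩ := IsFractionRing.div_surjective (A := B) θ
    obtain ⟨c, d, hd, h⟩ :=
      Algebra.IsAlgebraic.exists_smul_eq_mul A b (nonZeroDivisors.ne_zero hs)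
    refine ⟨d, hd, c, ?_⟩
    have hs' : algebraMap B L s ≠ 0 :=
      (map_ne_zero_iff _ (IsFractionRing.injective B L)).mpr (nonZeroDivisors.ne_zero hs)
    have h' := congrArg (algebraMap B L) h
    rw [Algebra.smul_def, map_mul, map_mul, ← IsScalarTower.algebraMap_apply] at h'
    change algebraMap B L c = d • θ
    rw [← hbs, Algebra.smul_def, ← mul_div_assoc, h', mul_div_cancel_left₀ _ hs']
  have hsep : ((minpoly A θ).map (algebraMap A K)).Separable := by
    rw [← minpoly.isIntegrallyClosed_eq_field_fractions' K hint]
    exact Algebra.IsSeparable.isSeparable K θ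
  obtain ⟨D, hD0, hD⟩ := exists_separable_map_of_separable hsep
  refine ⟨(minpoly A θ).natDegree, minpoly.natDegree_pos hint,
    D * F₂ * ∏ t ∈ T, a (algebraMap B L t),
    mul_ne_zero (mul_ne_zero hD0 hF₂0) (Finset.prod_ne_zero_iff.mpr fun t _ => ha0 _), ?_⟩
  set F := D * F₂ * ∏ t ∈ T, a (algebraMap B L t) with hF
  intro _ hFk
  have hFL : algebraMap A L F ≠ 0 := (map_ne_zero_iff _ (FaithfulSMul.algebraMap_injective A L)).mpr
    (mul_ne_zero (mul_ne_zero hD0 hF₂0) (Finset.prod_ne_zero_iff.mpr fun t _ => ha0 _))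
  have hCR : C ≤ R.awayClosure F := by
    refine Algebra.adjoin_le (Set.singleton_subset_iff.mpr ⟨1, ?_⟩)
    have : F = (D * ∏ t ∈ T, a (algebraMap B L t)) * F₂ := by rw [hF]; ring
    rw [pow_one, this, mul_smul]
    exact R.smul_mem hF₂ _
  have hRC : R ≤ C.awayClosure F := by
    change (IsScalarTower.toAlgHom A B L).range ≤ _
    rw [← Algebra.map_top, ← hT, Subalgebra.map_le, Algebra.adjoin_le_iff]
    intro t ht
    refine ⟨1, ?_⟩
    rw [pow_one, hF, ← Finset.prod_erase_mul _ _ ht, ← mul_assoc, mul_smul]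
    exact C.smul_mem (haC _) _
  have hRB : B ≃ₐ[A] R :=
    AlgEquiv.ofInjective (IsScalarTower.toAlgHom A B L) (IsFractionRing.injective B L)
  rw [Nat.card_congr (hRB.arrowCongr (AlgEquiv.refl : k ≃ₐ[A] k)),
    ← R.card_algHom_awayClosure F hFL hFk,
    le_antisymm (Subalgebra.awayClosure_le hRC) (Subalgebra.awayClosure_le hCR),
    C.card_algHom_awayClosure F hFL hFk]
  refine card_algHom_adjoin_singleton hint (hD _ fun h => hFk ?_)
  rw [hF, map_mul, map_mul, h, zero_mul, zero_mul]

open MvPolynomial in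
theorem exists_ncard_fiber_eq {ι σ : Type*} [Fintype ι] [Fintype σ] {f : ι → MvPolynomial σ ℂ}
    (hf : AlgebraicIndependent ℂ f) (hcard : Fintype.card σ ≤ Fintype.card ι) :
    ∃ n : ℕ, 0 < n ∧ ∃ F : MvPolynomial ι ℂ, F ≠ 0 ∧ ∀ lam : ι → ℂ, eval lam F ≠ 0 →
      {x : σ → ℂ | ∀ i, eval x (f i) = lam i}.ncard = n := by
  let _ : Algebra (MvPolynomial ι ℂ) (MvPolynomial σ ℂ) := (aeval f).toAlgebra
  have : FaithfulSMul (MvPolynomial ι ℂ) (MvPolynomial σ ℂ) :=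
    (faithfulSMul_iff_algebraMap_injective _ _).mpr hf
  have : IsScalarTower ℂ (MvPolynomial ι ℂ) (MvPolynomial σ ℂ) :=
    IsScalarTower.of_algebraMap_eq' (aeval f).comp_algebraMap.symm
  have : Algebra.FiniteType (MvPolynomial ι ℂ) (MvPolynomial σ ℂ) :=
    .of_restrictScalars_finiteType ℂ _ _
  have hb : IsTranscendenceBasis ℂ f := by
    refine hf.isTranscendenceBasis_of_lift_trdeg_le_of_finite ?_
    rw [MvPolynomial.trdeg_of_isDomain]
    simpa using hcard
  have : Algebra.IsAlgebraic (MvPolynomial ι ℂ) (MvPolynomial σ ℂ) := by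
    have halg := hb.isAlgebraic
    exact Algebra.IsAlgebraic.of_ringHom_of_comp_eq hf.aevalEquiv
      (RingHom.id (MvPolynomial σ ℂ)) hf.aevalEquiv.surjective Function.injective_id rfl
  obtain ⟨n, hn, F, hF, h⟩ := exists_card_algHom_eq (A := MvPolynomial ι ℂ)
    (B := MvPolynomial σ ℂ) ℂ
  refine ⟨n, hn, F, hF, fun lam hlam => ?_⟩
  let _ : Algebra (MvPolynomial ι ℂ) ℂ := (eval lam).toAlgebra
  rw [← h hlam, ← Nat.card_coe_set_eq]
  have hC : ∀ (ψ : MvPolynomial σ ℂ →ₐ[MvPolynomial ι ℂ] ℂ) (c : ℂ), ψ (C c) = c := fun ψ c => by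
    have h1 : algebraMap (MvPolynomial ι ℂ) (MvPolynomial σ ℂ) (C c) = C c := (aeval f).commutes c
    rw [← h1, ψ.commutes]
    exact eval_C c
  have hX : ∀ (ψ : MvPolynomial σ ℂ →ₐ[MvPolynomial ι ℂ] ℂ) (p : MvPolynomial σ ℂ),
      eval (fun s => ψ (X s)) p = ψ p := fun ψ p => by
    refine DFunLike.congr_fun (f := eval fun s => ψ (X s)) (g := (ψ : MvPolynomial σ ℂ →+* ℂ)) ?_ p
    exact ringHom_ext (fun c => by simp [hC]) (fun s => by simp)
  have hev : ∀ x : σ → ℂ, (∀ i, eval x (f i) = lam i) →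
      (eval x).comp (algebraMap (MvPolynomial ι ℂ) (MvPolynomial σ ℂ)) = eval lam := fun x hx => by
    refine ringHom_ext (fun c => ?_) (fun i => ?_)
    · change eval x (aeval f (C c)) = _
      simp
    · change eval x (aeval f (X i)) = _
      simpa using hx i
  refine Nat.card_congr
    { toFun := fun x =>
        { eval x.1 with commutes' := fun p => DFunLike.congr_fun (hev x.1 x.2) p }
      invFun := fun ψ => ⟨fun s => ψ (X s), fun i => ?_⟩
      left_inv := fun x => Subtype.ext (funext fun s => eval_X s)
      right_inv := fun ψ => AlgHom.ext (hX ψ) }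
  have h1 : algebraMap (MvPolynomial ι ℂ) (MvPolynomial σ ℂ) (X i) = f i := aeval_X f i
  rw [hX, ← h1, ψ.commutes]
  exact eval_X i

open MvPolynomial in
theorem algebraicIndependent_iff_forall_eval {ι σ : Type*} {f : ι → MvPolynomial σ ℂ} :
    AlgebraicIndependent ℂ f ↔
      ∀ P : MvPolynomial ι ℂ, (∀ x : σ → ℂ, eval (fun i => eval x (f i)) P = 0) → P = 0 := by
  have key : ∀ (P : MvPolynomial ι ℂ) (x : σ → ℂ),
      eval x (aeval f P) = eval (fun i => eval x (f i)) P := fun P x => by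
    have : (eval x).comp (aeval (R := ℂ) f).toRingHom = eval (fun i => eval x (f i)) :=
      ringHom_ext (fun c => by simp) (fun i => by simp)
    exact DFunLike.congr_fun this P
  rw [algebraicIndependent_iff]
  refine forall_congr' fun P => imp_congr_left ?_
  simp only [← key]
  exact ⟨fun h x => by rw [h, map_zero], fun h => MvPolynomial.funext fun x => by rw [h, map_zero]⟩

theorem AlgebraicIndependent.card_le_card {ι σ : Type*} [Fintype ι] [Fintype σ]
    {f : ι → MvPolynomial σ ℂ} (hf : AlgebraicIndependent ℂ f) :
    Fintype.card ι ≤ Fintype.card σ := by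
  have := hf.lift_cardinalMk_le_trdeg
  rw [MvPolynomial.trdeg_of_isDomain] at this
  simpa using this

open MvPolynomial in
theorem exists_eval_ne_zero {ι : Type*} {F : MvPolynomial ι ℂ} (hF : F ≠ 0) :
    ∃ x : ι → ℂ, eval x F ≠ 0 := by
  by_contra! h
  exact hF (MvPolynomial.funext fun x => by simp [h])

open MvPolynomial in
theorem infinite_setOf_eval_update_ne_zero {ι : Type*} [DecidableEq ι]
    {F : MvPolynomial ι ℂ} {x : ι → ℂ} (hx : eval x F ≠ 0) (j : ι) :
    {t : ℂ | eval (Function.update x j t) F ≠ 0}.Infinite := by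
  set q : Polynomial ℂ := aeval (fun i => if i = j then Polynomial.X else Polynomial.C (x i)) F
  have hq : ∀ t, q.eval t = eval (Function.update x j t) F := fun t => by
    have : (Polynomial.evalRingHom t).comp (aeval (R := ℂ)
        (fun i => if i = j then Polynomial.X else Polynomial.C (x i))).toRingHom =
        eval (Function.update x j t) := by
      refine ringHom_ext (fun c => by simp) (fun i => ?_)
      by_cases h : i = j <;> simp [h]
    exact DFunLike.congr_fun this F
  have hq0 : q ≠ 0 := fun h => hx (by
    have := hq (x j)
    rw [h, Function.update_eq_self, Polynomial.eval_zero] at this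
    exact this.symm)
  have := (Polynomial.finite_setOfPred_isRoot hq0).infinite_compl
  refine this.mono fun t ht => ?_
  rw [Set.mem_ofPred_eq, ← hq]
  exact ht

open MvPolynomial in
theorem exists_infinite_fiber {ι σ : Type*} [Fintype ι] [Fintype σ] {f : ι → MvPolynomial σ ℂ}
    (hf : AlgebraicIndependent ℂ f) (hcard : Fintype.card ι < Fintype.card σ)
    {F : MvPolynomial ι ℂ} (hF : F ≠ 0) :
    ∃ lam : ι → ℂ, eval lam F ≠ 0 ∧ {x : σ → ℂ | ∀ i, eval x (f i) = lam i}.Infinite := by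
  obtain ⟨s, hfs, hs⟩ := exists_isTranscendenceBasis_superset hf.to_subtype_range
  have hscard : Nat.card s = Fintype.card σ ∧ Finite s := by
    have h := hs.lift_cardinalMk_eq_trdeg
    rw [MvPolynomial.trdeg_of_isDomain] at h
    simp only [Cardinal.mk_fintype, Cardinal.lift_natCast, Cardinal.lift_id] at h
    have hfin : Finite s := by
      rw [← Cardinal.mk_lt_aleph0_iff, h]
      exact Cardinal.natCast_lt_aleph0
    refine ⟨?_, hfin⟩
    rw [Nat.card, h, Cardinal.toNat_natCast]
  obtain ⟨hscard, hfin⟩ := hscard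
  have := Fintype.ofFinite s
  rw [Nat.card_eq_fintype_card] at hscard
  obtain ⟨n, hn, G, hG, h⟩ := exists_ncard_fiber_eq hs.1 hscard.ge
  let e : ι → s := fun i => ⟨f i, hfs ⟨i, rfl⟩⟩
  have he : Function.Injective e := fun i j hij => hf.injective (congrArg Subtype.val hij)
  obtain ⟨j, hj⟩ : ∃ j : s, j ∉ Set.range e := by
    by_contra! hsurj
    exact absurd (Fintype.card_le_of_surjective e hsurj) (by omega)
  have hF' : rename e F ≠ 0 := fun h0 => hF (rename_injective e he (by rw [h0, map_zero]))
  obtain ⟨ν, hν⟩ := exists_eval_ne_zero (mul_ne_zero hG hF')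
  have hupd : ∀ t, (Function.update ν j t) ∘ e = ν ∘ e := fun t => by
    ext i
    exact Function.update_of_ne (fun h => hj ⟨i, h⟩) _ _
  refine ⟨ν ∘ e, ?_, ?_⟩
  · rw [map_mul, eval_rename] at hν
    exact right_ne_zero_of_mul hν
  · have hne : ∀ t ∈ {t : ℂ | eval (Function.update ν j t) (G * rename e F) ≠ 0},
        ∃ x : σ → ℂ, ∀ i : s, eval x i.1 = Function.update ν j t i := fun t ht => by
      rw [Set.mem_ofPred_eq, map_mul] at ht
      have := h _ (left_ne_zero_of_mul ht)
      have hne : {x : σ → ℂ | ∀ i : s, eval x i.1 = Function.update ν j t i}.Nonempty :=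
        Set.nonempty_of_ncard_ne_zero (by rw [this]; exact hn.ne')
      exact hne
    have := infinite_setOf_eval_update_ne_zero hν j
    choose! x hx using hne
    refine (this.image (f := x) fun t ht t' ht' htt => ?_).mono ?_
    · have h1 := hx t ht j
      have h2 := hx t' ht' j
      rw [htt] at h1
      simpa using h1.symm.trans h2
    · rintro _ ⟨t, ht, rfl⟩ i
      rw [← hupd t]
      exact hx t ht (e i)

section LamanCombinatorics

variable {α : Type*}

/-- The edges of `E` with both endpoints in `X`. -/
noncomputable def inducedEdges (E : Finset (Sym2 α)) (X : Finset α) : Finset (Sym2 α) :=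
  E.filter fun e => ∀ v ∈ e, v ∈ X

theorem mem_inducedEdges {E : Finset (Sym2 α)} {X : Finset α} {e : Sym2 α} :
    e ∈ inducedEdges E X ↔ e ∈ E ∧ ∀ v ∈ e, v ∈ X := by
  simp [inducedEdges]

/-- The Laman count condition on a set of edges. -/
def IsLamanSparse (E : Finset (Sym2 α)) : Prop :=
  (∀ e ∈ E, ¬ e.IsDiag) ∧
    ∀ X : Finset α, 2 ≤ X.card → (inducedEdges E X).card + 3 ≤ 2 * X.card

theorem inducedEdges_mono {E E' : Finset (Sym2 α)} (h : E ⊆ E') {X X' : Finset α} (hX : X ⊆ X') :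
    inducedEdges E X ⊆ inducedEdges E' X' := fun e he => by
  rw [mem_inducedEdges] at he ⊢
  exact ⟨h he.1, fun v hv => hX (he.2 v hv)⟩

theorem IsLamanSparse.mono {E E' : Finset (Sym2 α)} (hE' : IsLamanSparse E') (h : E ⊆ E') :
    IsLamanSparse E :=
  ⟨fun e he => hE'.1 e (h he), fun X hX =>
    (Nat.add_le_add_right (Finset.card_le_card (inducedEdges_mono h subset_rfl)) 3).trans
      (hE'.2 X hX)⟩

theorem IsLamanSparse.card_add_three_le {V : Finset α} {E : Finset (Sym2 α)}
    (hE : IsLamanSparse E) (hEV : ∀ e ∈ E, ∀ v ∈ e, v ∈ V) (hV : 2 ≤ V.card) :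
    E.card + 3 ≤ 2 * V.card := by
  have := hE.2 V hV
  rwa [inducedEdges, Finset.filter_true_of_mem hEV] at this

theorem IsLamanSparse.inducedEdges_eq_empty {E : Finset (Sym2 α)} (hE : IsLamanSparse E)
    {X : Finset α} (hX : X.card ≤ 1) : inducedEdges E X = ∅ := by
  refine Finset.eq_empty_of_forall_notMem fun e he => ?_
  rw [mem_inducedEdges] at he
  have := hE.1 e he.1
  induction e with | h a b =>
  rw [Sym2.mk_isDiag_iff] at this
  exact this (Finset.card_le_one.1 hX a (he.2 a (by simp)) b (he.2 b (by simp)))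

variable [DecidableEq α]

theorem inducedEdges_inter (E : Finset (Sym2 α)) (X Y : Finset α) :
    inducedEdges E X ∩ inducedEdges E Y = inducedEdges E (X ∩ Y) := by
  ext e
  simp only [Finset.mem_inter, mem_inducedEdges]
  grind

theorem card_inducedEdges_add_le (E : Finset (Sym2 α)) (X Y : Finset α) :
    (inducedEdges E X).card + (inducedEdges E Y).card ≤
      (inducedEdges E (X ∪ Y)).card + (inducedEdges E (X ∩ Y)).card := by
  rw [← Finset.card_union_add_card_inter, inducedEdges_inter]
  refine Nat.add_le_add_right (Finset.card_le_card (Finset.union_subset ?_ ?_)) _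
  · exact inducedEdges_mono subset_rfl Finset.subset_union_left
  · exact inducedEdges_mono subset_rfl Finset.subset_union_right

theorem IsLamanSparse.insert_or_exists {F : Finset (Sym2 α)} (hF : IsLamanSparse F) {v x y : α}
    (hv : ∀ e ∈ F, v ∉ e) (hxy : x ≠ y) (hxv : x ≠ v) (hyv : y ≠ v) :
    (s(x, y) ∉ F ∧ IsLamanSparse (insert s(x, y) F)) ∨
      ∃ X : Finset α, x ∈ X ∧ y ∈ X ∧ v ∉ X ∧ 2 * X.card ≤ (inducedEdges F X).card + 3 := by
  rw [or_iff_not_imp_right]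
  intro hbad
  have hbad : ∀ X : Finset α, x ∈ X → y ∈ X → (inducedEdges F X).card + 3 < 2 * X.card := by
    intro X hx hy
    by_contra! h
    refine hbad ⟨X.erase v, by simp [*], by simp [*], by simp, ?_⟩
    have h1 : inducedEdges F (X.erase v) = inducedEdges F X := by
      ext e
      simp only [mem_inducedEdges, Finset.mem_erase]
      exact and_congr_right fun he => forall₂_congr fun u hu =>
        and_iff_right fun huv => hv e he (huv ▸ hu)
    rw [h1]
    have := Finset.card_erase_le (s := X) (a := v)
    omega
  have hnot : s(x, y) ∉ F := fun h => by
    have h1 := hbad {x, y} (by simp) (by simp)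
    rw [Finset.card_pair hxy] at h1
    have : 0 < (inducedEdges F {x, y}).card :=
      Finset.card_pos.2 ⟨s(x, y), mem_inducedEdges.2 ⟨h, by simp⟩⟩
    omega
  refine ⟨hnot, ?_, fun X hX => ?_⟩
  · intro e he
    rcases Finset.mem_insert.1 he with rfl | he
    · simpa using hxy
    · exact hF.1 e he
  · by_cases hxyX : x ∈ X ∧ y ∈ X
    · have h1 : inducedEdges (insert s(x, y) F) X ⊆ insert s(x, y) (inducedEdges F X) := by
        intro e
        simp only [mem_inducedEdges, Finset.mem_insert]
        tauto
      have := (Finset.card_le_card h1).trans (Finset.card_insert_le _ _)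
      have := hbad X hxyX.1 hxyX.2
      omega
    · have h1 : inducedEdges (insert s(x, y) F) X ⊆ inducedEdges F X := by
        intro e
        simp only [mem_inducedEdges, Finset.mem_insert]
        rintro ⟨rfl | he, h⟩
        · exact absurd ⟨h x (by simp), h y (by simp)⟩ hxyX
        · exact ⟨he, h⟩
      have := Finset.card_le_card h1
      have := hF.2 X hX
      omega

/-- If `v` has exactly the three neighbours `a, b, c`, then deleting `v` and joining some pair of
neighbours keeps the Laman count. -/
theorem IsLamanSparse.exists_insert {E F : Finset (Sym2 α)} {v a b c : α} (hE : IsLamanSparse E)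
    (hFE : F ⊆ E) (hv : ∀ e ∈ F, v ∉ e) (hab : a ≠ b) (hac : a ≠ c) (hbc : b ≠ c)
    (hva : s(v, a) ∈ E) (hvb : s(v, b) ∈ E) (hvc : s(v, c) ∈ E) :
    (s(a, b) ∉ F ∧ IsLamanSparse (insert s(a, b) F)) ∨
      (s(a, c) ∉ F ∧ IsLamanSparse (insert s(a, c) F)) ∨
      (s(b, c) ∉ F ∧ IsLamanSparse (insert s(b, c) F)) := by
  have hF := hE.mono hFE
  have hne : ∀ x, s(v, x) ∈ E → x ≠ v := fun x hx h => hE.1 _ hx (by simp [h])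
  by_contra! hcon
  obtain ⟨X, haX, hbX, hvX, hX⟩ := (hF.insert_or_exists hv hab (hne a hva) (hne b hvb)).resolve_left
    fun h => hcon.1 h.1 h.2
  obtain ⟨Y, haY, hcY, hvY, hY⟩ := (hF.insert_or_exists hv hac (hne a hva) (hne c hvc)).resolve_left
    fun h => hcon.2.1 h.1 h.2
  obtain ⟨Z, hbZ, hcZ, hvZ, hZ⟩ := (hF.insert_or_exists hv hbc (hne b hvb) (hne c hvc)).resolve_left
    fun h => hcon.2.2 h.1 h.2
  have habc : ∀ W : Finset α, a ∈ W → b ∈ W → c ∈ W → v ∉ W →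
      (inducedEdges F W).card + 3 < 2 * W.card := by
    intro W ha hb hc hvW
    have hsub : inducedEdges F W ∪ {s(v, a), s(v, b), s(v, c)} ⊆
        inducedEdges E (insert v W) := by
      refine Finset.union_subset (inducedEdges_mono hFE (Finset.subset_insert _ _)) ?_
      intro e he
      simp only [Finset.mem_insert, Finset.mem_singleton] at he
      rw [mem_inducedEdges]
      rcases he with rfl | rfl | rfl <;> simp [*]
    have hdisj : Disjoint (inducedEdges F W) {s(v, a), s(v, b), s(v, c)} := by
      rw [Finset.disjoint_left]
      intro e he he'
      refine hv e (mem_inducedEdges.1 he).1 ?_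
      simp only [Finset.mem_insert, Finset.mem_singleton] at he'
      rcases he' with rfl | rfl | rfl <;> simp
    have h3 : ({s(v, a), s(v, b), s(v, c)} : Finset (Sym2 α)).card = 3 :=
      Finset.card_eq_three.2 ⟨_, _, _, by simp [hab, hne a hva], by simp [hac, hne a hva],
      by simp [hbc, hne b hvb],
        rfl⟩
    have h4 := Finset.card_le_card hsub
    rw [Finset.card_union_of_disjoint hdisj, h3] at h4
    have h5 : 0 < W.card := Finset.card_pos.2 ⟨a, ha⟩
    have h6 := hE.2 (insert v W) (by rw [Finset.card_insert_of_notMem hvW]; omega)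
    rw [Finset.card_insert_of_notMem hvW] at h6
    omega
  have hinter : ∀ P Q : Finset α, 2 * P.card ≤ (inducedEdges F P).card + 3 →
      2 * Q.card ≤ (inducedEdges F Q).card + 3 → a ∈ P ∪ Q → b ∈ P ∪ Q → c ∈ P ∪ Q → v ∉ P →
      v ∉ Q → (P ∩ Q).card ≤ 1 := by
    intro P Q hP hQ ha hb hc hvP hvQ
    by_contra! h2
    have h3 := hF.2 _ h2
    have h4 := habc (P ∪ Q) ha hb hc (by simp [*])
    have h5 := card_inducedEdges_add_le F P Q
    have h6 := Finset.card_union_add_card_inter P Q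
    omega
  have hXY := hinter X Y hX hY (by simp [*]) (by simp [*]) (by simp [*]) hvX hvY
  have hXZ := hinter X Z hX hZ (by simp [*]) (by simp [*]) (by simp [*]) hvX hvZ
  have hYZ := hinter Y Z hY hZ (by simp [*]) (by simp [*]) (by simp [*]) hvY hvZ
  have hdXY : Disjoint (inducedEdges F X) (inducedEdges F Y) := by
    rw [Finset.disjoint_iff_inter_eq_empty, inducedEdges_inter, hF.inducedEdges_eq_empty hXY]
  have hdXZ : Disjoint (inducedEdges F X) (inducedEdges F Z) := by
    rw [Finset.disjoint_iff_inter_eq_empty, inducedEdges_inter, hF.inducedEdges_eq_empty hXZ]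
  have hdYZ : Disjoint (inducedEdges F Y) (inducedEdges F Z) := by
    rw [Finset.disjoint_iff_inter_eq_empty, inducedEdges_inter, hF.inducedEdges_eq_empty hYZ]
  have hU := habc (X ∪ Y ∪ Z) (by simp [*]) (by simp [*]) (by simp [*]) (by simp [*])
  have hsub : inducedEdges F X ∪ inducedEdges F Y ∪ inducedEdges F Z ⊆
      inducedEdges F (X ∪ Y ∪ Z) := by
    refine Finset.union_subset (Finset.union_subset ?_ ?_) ?_ <;>
      exact inducedEdges_mono subset_rfl (fun x hx => by simp [hx])
  have hcard := Finset.card_le_card hsub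
  rw [Finset.card_union_of_disjoint (Finset.disjoint_union_left.2 ⟨hdXZ, hdYZ⟩),
    Finset.card_union_of_disjoint hdXY] at hcard
  have h1 := Finset.card_union_add_card_inter X Y
  have h2 := Finset.card_union_add_card_inter (X ∪ Y) Z
  have h3 : 1 ≤ (X ∩ Y).card := Finset.card_pos.2 ⟨a, by simp [*]⟩
  have h4 : 2 ≤ ((X ∪ Y) ∩ Z).card := by
    rw [← Finset.card_pair hbc]
    exact Finset.card_le_card fun x hx => by
      simp only [Finset.mem_insert, Finset.mem_singleton] at hx
      rcases hx with rfl | rfl <;> simp [*]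
  omega

theorem sum_card_filter_mem_eq {V : Finset α} {E : Finset (Sym2 α)} (hE : ∀ e ∈ E, ¬ e.IsDiag)
    (hEV : ∀ e ∈ E, ∀ v ∈ e, v ∈ V) :
    ∑ v ∈ V, (E.filter fun e => v ∈ e).card = 2 * E.card := by
  have := Finset.sum_card_bipartiteAbove_eq_sum_card_bipartiteBelow (s := V) (t := E)
    (fun v e => v ∈ e)
  unfold Finset.bipartiteAbove Finset.bipartiteBelow at this
  rw [this, mul_comm, ← smul_eq_mul, ← Finset.sum_const]
  refine Finset.sum_congr rfl fun e he => ?_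
  have h1 := hE e he
  have h2 := hEV e he
  induction e with | h a b =>
  rw [Sym2.mk_isDiag_iff] at h1
  rw [← Finset.card_pair h1]
  congr 1
  ext x
  simp only [Finset.mem_filter, Sym2.mem_iff, Finset.mem_insert, Finset.mem_singleton]
  refine and_iff_right_of_imp ?_
  rintro (rfl | rfl) <;> exact h2 _ (by simp)

theorem IsLamanSparse.exists_card_filter_le_three {V : Finset α} {E : Finset (Sym2 α)}
    (hE : IsLamanSparse E) (hEV : ∀ e ∈ E, ∀ v ∈ e, v ∈ V) (hV : 2 ≤ V.card) :
    ∃ v ∈ V, (E.filter fun e => v ∈ e).card ≤ 3 := by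
  by_contra! h
  have h1 := Finset.card_nsmul_le_sum V (fun v => (E.filter fun e => v ∈ e).card) 4 h
  rw [sum_card_filter_mem_eq hE.1 hEV, smul_eq_mul] at h1
  have := hE.card_add_three_le hEV hV
  omega

end LamanCombinatorics

section InfinitesimalRigidity

variable {α : Type*}

/-- The squared edge length in isotropic coordinates `z = x + iy`, `w = x - iy`. -/
def isotropicEdge {R : Type*} [CommRing R] (z w : α → R) : Sym2 α → R :=
  Sym2.lift ⟨fun u v => (z u - z v) * (w u - w v), fun u v => by ring⟩

/-- The derivative of `isotropicEdge` at `(z, w)` in the direction `(z', w')`. -/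
def isotropicEdgeDeriv {R : Type*} [CommRing R] (z w z' w' : α → R) : Sym2 α → R :=
  Sym2.lift ⟨fun u v => (z u - z v) * (w' u - w' v) + (w u - w v) * (z' u - z' v),
    fun u v => by ring⟩

@[simp]
theorem isotropicEdge_mk {R : Type*} [CommRing R] (z w : α → R) (u v : α) :
    isotropicEdge z w s(u, v) = (z u - z v) * (w u - w v) := rfl

@[simp]
theorem isotropicEdgeDeriv_mk {R : Type*} [CommRing R] (z w z' w' : α → R) (u v : α) :
    isotropicEdgeDeriv z w z' w' s(u, v) =
      (z u - z v) * (w' u - w' v) + (w u - w v) * (z' u - z' v) := rfl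

/-- The edge map of `E` has surjective derivative at `(z, w)`. -/
def IsRegularAt (E : Finset (Sym2 α)) (z w : α → ℂ) : Prop :=
  ∀ lam : Sym2 α → ℂ, ∃ z' w' : α → ℂ, ∀ e ∈ E, isotropicEdgeDeriv z w z' w' e = lam e

theorem IsRegularAt.mono {E E' : Finset (Sym2 α)} {z w : α → ℂ} (h : IsRegularAt E' z w)
    (hE : E ⊆ E') : IsRegularAt E z w := fun lam => by
  obtain ⟨z', w', h'⟩ := h lam
  exact ⟨z', w', fun e he => h' e (hE he)⟩

theorem isotropicEdgeDeriv_sum {ι : Type*} (s : Finset ι) (c : ι → ℂ) (z w : α → ℂ)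
    (Z W : ι → α → ℂ) (e : Sym2 α) :
    isotropicEdgeDeriv z w (fun v => ∑ i ∈ s, c i * Z i v) (fun v => ∑ i ∈ s, c i * W i v) e =
      ∑ i ∈ s, c i * isotropicEdgeDeriv z w (Z i) (W i) e := by
  induction e with | h a b =>
  simp only [isotropicEdgeDeriv_mk, ← Finset.sum_sub_distrib, Finset.mul_sum,
    ← Finset.sum_add_distrib]
  exact Finset.sum_congr rfl fun i _ => by ring

open Filter Topology in
theorem IsRegularAt.eventually {E : Finset (Sym2 α)} {z w : α → ℂ} (h : IsRegularAt E z w)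
    (z₁ w₁ : α → ℂ) :
    ∀ᶠ t : ℂ in 𝓝 0, IsRegularAt E (fun v => z v + t * z₁ v) (fun v => w v + t * w₁ v) := by
  choose Z W hZW using fun e : Sym2 α => h (Pi.single e 1)
  let M : ℂ → Matrix E E ℂ := fun t => Matrix.of fun e e' =>
    isotropicEdgeDeriv (fun v => z v + t * z₁ v) (fun v => w v + t * w₁ v) (Z e') (W e') e
  have hM : Continuous M := by
    refine continuous_matrix fun e e' => ?_
    obtain ⟨e, he⟩ := e
    induction e with | h a b =>
    simp only [M, Matrix.of_apply, isotropicEdgeDeriv_mk]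
    fun_prop
  have hM0 : M 0 = 1 := by
    ext e e'
    have := hZW e'.1 e.1 e.2
    simp only [M, Matrix.of_apply, zero_mul, add_zero, this, Matrix.one_apply, Pi.single_apply,
      Subtype.ext_iff]
  have hdet : ∀ᶠ t in 𝓝 0, (M t).det ≠ 0 :=
    hM.matrix_det.continuousAt.eventually_ne (by rw [hM0, Matrix.det_one]; exact one_ne_zero)
  filter_upwards [hdet] with t ht lam
  let c : E → ℂ := (M t)⁻¹.mulVec fun e => lam e
  refine ⟨_, _, fun e he =>
    (isotropicEdgeDeriv_sum Finset.univ c _ _ (fun e => Z e.1) (fun e => W e.1) e).trans ?_⟩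
  have hc : (M t).mulVec c = fun e : E => lam e := by
    rw [Matrix.mulVec_mulVec, Matrix.mul_nonsing_inv _ ht.isUnit, Matrix.one_mulVec]
  have := congrFun hc ⟨e, he⟩
  simp only [Matrix.mulVec, dotProduct, M, Matrix.of_apply] at this
  rw [← this]
  exact Finset.sum_congr rfl fun i _ => mul_comm _ _

open Filter Topology in
theorem IsRegularAt.exists_eval_ne_zero {E : Finset (Sym2 α)} {z w : α → ℂ}
    (h : IsRegularAt E z w) (z₁ w₁ : α → ℂ) {q : Polynomial ℂ} (hq : q ≠ 0) :
    ∃ t : ℂ, IsRegularAt E (fun v => z v + t * z₁ v) (fun v => w v + t * w₁ v) ∧ q.eval t ≠ 0 := by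
  have h1 : ∀ᶠ t in 𝓝[≠] (0 : ℂ), q.eval t ≠ 0 := by
    have h2 : ∀ᶠ t in 𝓝[≠] (0 : ℂ), ¬ q.IsRoot t := by
      have h3 := ((Polynomial.finite_setOfPred_isRoot hq).subset
        (Set.sdiff_subset (t := {0}))).isClosed.isOpen_compl.mem_nhds (x := (0 : ℂ)) (by simp)
      rw [eventually_nhdsWithin_iff]
      filter_upwards [h3] with t ht ht0 hroot
      exact ht ⟨hroot, ht0⟩
    exact h2
  obtain ⟨t, ht⟩ := (((h.eventually z₁ w₁).filter_mono nhdsWithin_le_nhds).and h1).exists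
  exact ⟨t, ht⟩

/-- Twice the signed area of the triangle `a b c` in isotropic coordinates. -/
def isotropicArea (z w : α → ℂ) (a b c : α) : ℂ :=
  (z b - z a) * (w c - w a) - (z c - z a) * (w b - w a)

open Polynomial in
theorem IsRegularAt.exists_isotropicArea_ne_zero {E : Finset (Sym2 α)} {z w : α → ℂ}
    (h : IsRegularAt E z w) {a b c : α} (hab : a ≠ b) (hac : a ≠ c) (hbc : b ≠ c) :
    ∃ z w, IsRegularAt E z w ∧ isotropicArea z w a b c ≠ 0 := by
  let q : ℂ[X] := (X + C (z b - z a)) * (X + C (w c - w a)) - C ((z c - z a) * (w b - w a))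
  have hq : q ≠ 0 := fun h0 => by
    have : q.coeff 2 = 1 := by
      have : q = X ^ 2 + C (z b - z a + (w c - w a)) * X +
          C ((z b - z a) * (w c - w a) - (z c - z a) * (w b - w a)) := by
        simp only [q, C_add, C_sub, C_mul]
        ring
      rw [this, coeff_add, coeff_add, coeff_C_mul, coeff_X, coeff_C, coeff_X_pow]
      norm_num
    simp [h0] at this
  obtain ⟨t, ht, hqt⟩ := h.exists_eval_ne_zero (Pi.single b 1) (Pi.single c 1) hq
  refine ⟨_, _, ht, fun h0 => hqt ?_⟩
  rw [isotropicArea] at h0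
  simp [hab, hac, hbc, hbc.symm] at h0
  simp only [q, eval_sub, eval_mul, eval_add, eval_X, eval_C]
  linear_combination h0

open Polynomial in
theorem IsRegularAt.exists_ne {E : Finset (Sym2 α)} {z w : α → ℂ}
    (h : IsRegularAt E z w) {a b : α} (hab : a ≠ b) :
    ∃ z w, IsRegularAt E z w ∧ z a ≠ z b := by
  obtain ⟨t, ht, hqt⟩ := h.exists_eval_ne_zero (Pi.single b 1) 0
    (Polynomial.X_add_C_ne_zero (z b - z a))
  refine ⟨_, _, ht, fun h0 => hqt ?_⟩
  simp [hab] at h0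
  simp only [eval_add, eval_X, eval_C]
  linear_combination -h0

theorem exists_solution_of_det_ne_zero {p q r s : ℂ} (h : p * s - q * r ≠ 0) (l m : ℂ) :
    ∃ x y, p * x + q * y = l ∧ r * x + s * y = m :=
  ⟨(s * l - q * m) / (p * s - q * r), (p * m - r * l) / (p * s - q * r), by
    constructor
    · rw [mul_div_assoc', mul_div_assoc', ← add_div, div_eq_iff h]
      ring
    · rw [mul_div_assoc', mul_div_assoc', ← add_div, div_eq_iff h]
      ring⟩

variable [DecidableEq α]

theorem isotropicEdgeDeriv_update {z w z' w' : α → ℂ} {v : α} {x y x' y' : ℂ} {e : Sym2 α}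
    (hv : v ∉ e) :
    isotropicEdgeDeriv (Function.update z v x) (Function.update w v y) (Function.update z' v x')
      (Function.update w' v y') e = isotropicEdgeDeriv z w z' w' e := by
  induction e with | h a b =>
  simp only [Sym2.mem_iff, not_or] at hv
  simp [hv.1, hv.2, Ne.symm]

theorem isotropicEdgeDeriv_update_right {z w z' w' : α → ℂ} {v : α} {x' y' : ℂ} {e : Sym2 α}
    (hv : v ∉ e) :
    isotropicEdgeDeriv z w (Function.update z' v x') (Function.update w' v y') e =
      isotropicEdgeDeriv z w z' w' e := by
  simpa using isotropicEdgeDeriv_update (z := z) (w := w) (z' := z') (w' := w') (x := z v)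
    (y := w v) (x' := x') (y' := y') hv

theorem IsRegularAt.exists_insert_two {E : Finset (Sym2 α)} {z w : α → ℂ}
    (h : IsRegularAt E z w) {v a b : α} (hv : ∀ e ∈ E, v ∉ e) (hav : a ≠ v) (hbv : b ≠ v)
    (hab : a ≠ b) :
    ∃ z w, IsRegularAt (insert s(v, a) (insert s(v, b) E)) z w := by
  obtain ⟨z, w, h, hD⟩ := h.exists_isotropicArea_ne_zero hav.symm hbv.symm hab
  refine ⟨z, w, fun lam => ?_⟩
  obtain ⟨z', w', h'⟩ := h lam
  obtain ⟨x, y, hx, hy⟩ := exists_solution_of_det_ne_zero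
    (p := w v - w a) (q := z v - z a) (r := w v - w b) (s := z v - z b)
    (fun h0 => hD (by rw [isotropicArea]; linear_combination -h0))
    (lam s(v, a) + (w v - w a) * z' a + (z v - z a) * w' a)
    (lam s(v, b) + (w v - w b) * z' b + (z v - z b) * w' b)
  refine ⟨Function.update z' v x, Function.update w' v y, fun e he => ?_⟩
  simp only [Finset.mem_insert] at he
  rcases he with rfl | rfl | he
  · simp [hav]
    linear_combination hx
  · simp [hbv]
    linear_combination hy
  · rw [isotropicEdgeDeriv_update_right (hv e he), h' e he]

theorem IsRegularAt.exists_insert_three {E : Finset (Sym2 α)} {z w : α → ℂ} {v a b c : α}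
    (h : IsRegularAt (insert s(a, b) E) z w) (habE : s(a, b) ∉ E) (hv : ∀ e ∈ E, v ∉ e)
    (hav : a ≠ v) (hbv : b ≠ v) (hcv : c ≠ v) (hab : a ≠ b) (hac : a ≠ c) (hbc : b ≠ c) :
    ∃ z w, IsRegularAt (insert s(v, a) (insert s(v, b) (insert s(v, c) E))) z w := by
  obtain ⟨z, w, h, hD⟩ := h.exists_isotropicArea_ne_zero hab hac hbc
  refine ⟨Function.update z v ((z a + z b) / 2), Function.update w v ((w a + w b) / 2),
    fun lam => ?_⟩
  obtain ⟨z', w', h'⟩ := h (Function.update lam s(a, b) (2 * (lam s(v, a) + lam s(v, b))))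
  have hE : ∀ e ∈ E, isotropicEdgeDeriv z w z' w' e = lam e := fun e he => by
    rw [h' e (Finset.mem_insert_of_mem he), Function.update_of_ne]
    rintro rfl
    exact habE he
  have hs := h' _ (Finset.mem_insert_self _ _)
  rw [Function.update_self, isotropicEdgeDeriv_mk] at hs
  obtain ⟨x, y, hx, hy⟩ := exists_solution_of_det_ne_zero
    (p := (w a + w b) / 2 - w a) (q := (z a + z b) / 2 - z a)
    (r := (w a + w b) / 2 - w c) (s := (z a + z b) / 2 - z c)
    (fun h0 => hD (by rw [isotropicArea]; linear_combination 2 * h0))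
    (lam s(v, a) + ((w a + w b) / 2 - w a) * z' a + ((z a + z b) / 2 - z a) * w' a)
    (lam s(v, c) + ((w a + w b) / 2 - w c) * z' c + ((z a + z b) / 2 - z c) * w' c)
  refine ⟨Function.update z' v x, Function.update w' v y, fun e he => ?_⟩
  simp only [Finset.mem_insert] at he
  rcases he with rfl | rfl | rfl | he
  · simp [hav]
    linear_combination hx
  · simp [hbv]
    linear_combination -hx + hs / 2
  · simp [hcv]
    linear_combination hy
  · rw [isotropicEdgeDeriv_update (hv e he), hE e he]

theorem IsLamanSparse.exists_isRegularAt {V : Finset α} {E : Finset (Sym2 α)}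
    (hE : IsLamanSparse E) (hEV : ∀ e ∈ E, ∀ v ∈ e, v ∈ V) : ∃ z w, IsRegularAt E z w := by
  induction hn : V.card using Nat.strong_induction_on generalizing V E with | _ n ih
  by_cases hV : V.card ≤ 2
  · have hE1 : E.card ≤ 1 := by
      rcases E.eq_empty_or_nonempty with rfl | ⟨e, he⟩
      · simp
      have h1 := hE.1 e he
      have h2 := hEV e he
      have : 2 ≤ V.card := by
        induction e with | h a b =>
        rw [Sym2.mk_isDiag_iff] at h1
        rw [← Finset.card_pair h1]
        refine Finset.card_le_card fun x hx => h2 x (by simpa using hx)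
      have := hE.card_add_three_le hEV this
      omega
    rcases E.eq_empty_or_nonempty with rfl | ⟨e, he⟩
    · exact ⟨0, 0, fun _ => ⟨0, 0, by simp⟩⟩
    have h1 := hE.1 e he
    have h3 := Finset.card_le_one.1 hE1
    induction e with | h a b =>
    rw [Sym2.mk_isDiag_iff] at h1
    refine ⟨Pi.single a 1, 0, fun lam => ⟨0, Pi.single a (lam s(a, b)), fun e he' => ?_⟩⟩
    rw [h3 e he' _ he]
    simp [Ne.symm h1]
  push Not at hV
  obtain ⟨v, hv, hdeg⟩ := hE.exists_card_filter_le_three hEV hV.le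
  set F := E.filter fun e => v ∉ e with hF
  set N := V.filter fun u => s(v, u) ∈ E with hN
  have hFE : F ⊆ E := Finset.filter_subset _ _
  have hFv : ∀ e ∈ F, v ∉ e := fun e he => (Finset.mem_filter.1 he).2
  have hFV : ∀ e ∈ F, ∀ u ∈ e, u ∈ V.erase v := fun e he u hu =>
    Finset.mem_erase.2 ⟨fun h => hFv e he (h ▸ hu), hEV e (hFE he) u hu⟩
  have hNV : N ⊆ V.erase v := fun u hu => by
    rw [hN, Finset.mem_filter] at hu
    exact Finset.mem_erase.2 ⟨fun h => hE.1 _ hu.2 (by simp [h]), hu.1⟩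
  have hcard := Finset.card_erase_of_mem hv
  have hNcard : N.card ≤ 3 := by
    refine le_trans (Finset.card_le_card_of_injOn (fun u => s(v, u)) (fun u hu => ?_) ?_) hdeg
    · have := (Finset.mem_filter.1 hu).2
      simpa using this
    · intro x _ y _ hxy
      exact Sym2.congr_right.1 hxy
  have hEN : ∀ e ∈ E, e ∈ F ∨ ∃ u ∈ N, e = s(v, u) := fun e he => by
    by_cases hve : v ∈ e
    · obtain ⟨u, rfl⟩ := Sym2.mem_iff_exists.1 hve
      exact Or.inr ⟨u, Finset.mem_filter.2 ⟨hEV _ he u (by simp), he⟩, rfl⟩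
    · exact Or.inl (Finset.mem_filter.2 ⟨he, hve⟩)
  by_cases hN2 : N.card ≤ 2
  · obtain ⟨M, hNM, hMV, hM⟩ := Finset.exists_subsuperset_card_eq hNV hN2 (by omega)
    obtain ⟨a, b, hab, rfl⟩ := Finset.card_eq_two.1 hM
    obtain ⟨z, w, h⟩ := ih _ (by omega) (hE.mono hFE) hFV rfl
    have ha := Finset.ne_of_mem_erase (hMV (Finset.mem_insert_self a {b}))
    have hb := Finset.ne_of_mem_erase (hMV (Finset.mem_insert_of_mem (Finset.mem_singleton_self b)))
    obtain ⟨z, w, h⟩ := h.exists_insert_two hFv ha hb hab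
    refine ⟨z, w, h.mono fun e he => ?_⟩
    rcases hEN e he with he | ⟨u, hu, rfl⟩
    · simp [he]
    · have := hNM hu
      simp only [Finset.mem_insert, Finset.mem_singleton] at this
      rcases this with rfl | rfl <;> simp
  · obtain ⟨a, b, c, hab, hac, hbc, hNabc⟩ := Finset.card_eq_three.1 (show N.card = 3 by omega)
    have hmem : ∀ u ∈ N, u ≠ v ∧ u ∈ V.erase v ∧ s(v, u) ∈ E := fun u hu =>
      ⟨Finset.ne_of_mem_erase (hNV hu), hNV hu, (Finset.mem_filter.1 hu).2⟩
    obtain ⟨hav, haV, haE⟩ := hmem a (by simp [hNabc])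
    obtain ⟨hbv, hbV, hbE⟩ := hmem b (by simp [hNabc])
    obtain ⟨hcv, hcV, hcE⟩ := hmem c (by simp [hNabc])
    have hexists : ∀ x y u : α, x ≠ y → x ≠ u → y ≠ u → x ≠ v → y ≠ v → u ≠ v → x ∈ V.erase v →
        y ∈ V.erase v → N ⊆ {x, y, u} → s(x, y) ∉ F ∧ IsLamanSparse (insert s(x, y) F) →
        ∃ z w, IsRegularAt E z w := by
      intro x y u hxy hxu hyu hxv hyv huv hxV hyV hNxyu ⟨hxyF, hs⟩
      obtain ⟨z, w, h⟩ := ih _ (by omega) hs (V := V.erase v) (fun e he => by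
        rcases Finset.mem_insert.1 he with rfl | he
        · intro t ht
          rcases Sym2.mem_iff.1 ht with rfl | rfl <;> assumption
        · exact hFV e he) rfl
      obtain ⟨z, w, h⟩ := h.exists_insert_three hxyF hFv hxv hyv huv hxy hxu hyu
      refine ⟨z, w, h.mono fun e he => ?_⟩
      rcases hEN e he with he | ⟨t, ht, rfl⟩
      · simp [he]
      · have := hNxyu ht
        simp only [Finset.mem_insert, Finset.mem_singleton] at this
        rcases this with rfl | rfl | rfl <;> simp
    rcases hE.exists_insert hFE hFv hab hac hbc haE hbE hcE with h | h | h
    · exact hexists a b c hab hac hbc hav hbv hcv haV hbV hNabc.subset h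
    · exact hexists a c b hac hab hbc.symm hav hcv hbv haV hcV
        (hNabc.subset.trans (by intro t; simp; tauto)) h
    · exact hexists b c a hbc hab.symm hac.symm hbv hcv hav hbV hcV
        (hNabc.subset.trans (by intro t; simp; tauto)) h

end InfinitesimalRigidity

section PinnedFamily

open MvPolynomial Filter Topology

variable {α : Type*}

/-- The first isotropic coordinate of a realization of `V`, extended by zero. -/
noncomputable def zCoord {R : Type*} [Zero R] (V : Finset α) (x : V ⊕ V → R) (v : α) : R :=
  if h : v ∈ V then x (Sum.inl ⟨v, h⟩) else 0

/-- The second isotropic coordinate of a realization of `V`, extended by zero. -/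
noncomputable def wCoord {R : Type*} [Zero R] (V : Finset α) (x : V ⊕ V → R) (v : α) : R :=
  if h : v ∈ V then x (Sum.inr ⟨v, h⟩) else 0

/-- The squared edge lengths, together with the coordinates that pin a realization. -/
def pinnedMap {R : Type*} [CommRing R] (E : Finset (Sym2 α)) (a b : α) (z w : α → R) :
    {e // e ∈ E} ⊕ Fin 3 → R :=
  Sum.elim (fun e => isotropicEdge z w e.1) ![z a, w a, z b - z a]

/-- The polynomials defining `pinnedMap` on the realizations of `V`. -/
noncomputable def pinnedPoly (V : Finset α) (E : Finset (Sym2 α)) (a b : α) :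
    {e // e ∈ E} ⊕ Fin 3 → MvPolynomial (V ⊕ V) ℂ :=
  pinnedMap E a b (zCoord V X) (wCoord V X)

theorem map_isotropicEdge {R S : Type*} [CommRing R] [CommRing S] (φ : R →+* S) (z w : α → R)
    (e : Sym2 α) : φ (isotropicEdge z w e) = isotropicEdge (φ ∘ z) (φ ∘ w) e := by
  induction e with | h a b => simp

theorem map_pinnedMap {R S : Type*} [CommRing R] [CommRing S] (φ : R →+* S)
    (E : Finset (Sym2 α)) (a b : α) (z w : α → R) (i : {e // e ∈ E} ⊕ Fin 3) :
    φ (pinnedMap E a b z w i) = pinnedMap E a b (φ ∘ z) (φ ∘ w) i := by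
  rcases i with e | i
  · exact map_isotropicEdge φ z w e.1
  · fin_cases i <;> simp [pinnedMap]

theorem map_zCoord {R S : Type*} [CommRing R] [CommRing S] (φ : R →+* S) (V : Finset α)
    (x : V ⊕ V → R) : φ ∘ zCoord V x = zCoord V (φ ∘ x) := by
  ext v
  by_cases h : v ∈ V <;> simp [zCoord, h]

theorem map_wCoord {R S : Type*} [CommRing R] [CommRing S] (φ : R →+* S) (V : Finset α)
    (x : V ⊕ V → R) : φ ∘ wCoord V x = wCoord V (φ ∘ x) := by
  ext v
  by_cases h : v ∈ V <;> simp [wCoord, h]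

theorem eval_pinnedPoly (V : Finset α) (E : Finset (Sym2 α)) (a b : α) (x : V ⊕ V → ℂ)
    (i : {e // e ∈ E} ⊕ Fin 3) :
    eval x (pinnedPoly V E a b i) = pinnedMap E a b (zCoord V x) (wCoord V x) i := by
  have : eval x ∘ X = x := by
    ext i
    simp
  rw [pinnedPoly, map_pinnedMap, map_zCoord, map_wCoord, this]

theorem isotropicEdge_congr {R : Type*} [CommRing R] {z w z' w' : α → R} {e : Sym2 α}
    (hz : ∀ v ∈ e, z v = z' v) (hw : ∀ v ∈ e, w v = w' v) :
    isotropicEdge z w e = isotropicEdge z' w' e := by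
  induction e with | h a b => simp [hz a, hz b, hw a, hw b]

theorem pinnedMap_congr {R : Type*} [CommRing R] {V : Finset α} {E : Finset (Sym2 α)}
    (hEV : ∀ e ∈ E, ∀ v ∈ e, v ∈ V) {a b : α} (ha : a ∈ V) (hb : b ∈ V) {z w z' w' : α → R}
    (hz : ∀ v ∈ V, z v = z' v) (hw : ∀ v ∈ V, w v = w' v) :
    pinnedMap E a b z w = pinnedMap E a b z' w' := by
  ext (e | i)
  · exact isotropicEdge_congr (fun v hv => hz v (hEV _ e.2 v hv)) fun v hv =>
      hw v (hEV _ e.2 v hv)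
  · fin_cases i <;> simp [pinnedMap, hz a ha, hz b hb, hw a ha]

theorem pinnedMap_zCoord_wCoord {R : Type*} [CommRing R] {V : Finset α} {E : Finset (Sym2 α)}
    (hEV : ∀ e ∈ E, ∀ v ∈ e, v ∈ V) {a b : α} (ha : a ∈ V) (hb : b ∈ V) (z w : α → R) :
    pinnedMap E a b (zCoord V (Sum.elim (fun v => z v) (fun v => w v)))
      (wCoord V (Sum.elim (fun v => z v) (fun v => w v))) = pinnedMap E a b z w :=
  pinnedMap_congr hEV ha hb (fun v hv => by simp [zCoord, hv]) (fun v hv => by simp [wCoord, hv])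

theorem algebraicIndependent_pinnedPoly_iff {V : Finset α} {E : Finset (Sym2 α)}
    (hEV : ∀ e ∈ E, ∀ v ∈ e, v ∈ V) {a b : α} (ha : a ∈ V) (hb : b ∈ V) :
    AlgebraicIndependent ℂ (pinnedPoly V E a b) ↔
      ∀ P : MvPolynomial ({e // e ∈ E} ⊕ Fin 3) ℂ,
        (∀ z w : α → ℂ, eval (pinnedMap E a b z w) P = 0) → P = 0 := by
  rw [algebraicIndependent_iff_forall_eval]
  refine forall_congr' fun P => imp_congr_left ?_
  simp only [eval_pinnedPoly]
  refine ⟨fun h z w => ?_, fun h x => h _ _⟩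
  rw [← pinnedMap_zCoord_wCoord hEV ha hb]
  exact h _

theorem isotropicEdge_smul_add {z w : α → ℂ} {ζ : ℂ} (hζ : ζ ≠ 0) (p q : ℂ) (e : Sym2 α) :
    isotropicEdge (fun v => ζ * z v + p) (fun v => ζ⁻¹ * w v + q) e = isotropicEdge z w e := by
  induction e with | h a b =>
  simp only [isotropicEdge_mk]
  field_simp
  ring

theorem isotropicEdgeDeriv_add {z w z' w' : α → ℂ} (θ p q : ℂ) (e : Sym2 α) :
    isotropicEdgeDeriv z w (fun v => z' v + θ * z v + p) (fun v => w' v - θ * w v + q) e =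
      isotropicEdgeDeriv z w z' w' e := by
  induction e with | h a b =>
  simp only [isotropicEdgeDeriv_mk]
  ring

theorem eq_zero_of_eventually_eval_eq_zero {ι : Type*} [Fintype ι] {P : MvPolynomial ι ℂ}
    {y : ι → ℂ} (h : ∀ᶠ x in 𝓝 y, eval x P = 0) : P = 0 := by
  obtain ⟨r, hr, hball⟩ := Metric.mem_nhds_iff.1 h
  refine MvPolynomial.funext_set (fun i => Metric.ball (y i) r)
    (fun i => infinite_of_mem_nhds (y i) (Metric.ball_mem_nhds _ hr)) fun x hx => ?_
  rw [← ball_pi y hr] at hx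
  rw [map_zero]
  exact hball hx

theorem exists_zCoord (V : Finset α) (v : α) :
    ∃ L : (V ⊕ V → ℂ) →L[ℂ] ℂ, ∀ x, L x = zCoord V x v := by
  by_cases h : v ∈ V
  · exact ⟨ContinuousLinearMap.proj (Sum.inl ⟨v, h⟩), fun x => by simp [zCoord, h]⟩
  · exact ⟨0, fun x => by simp [zCoord, h]⟩

theorem exists_wCoord (V : Finset α) (v : α) :
    ∃ L : (V ⊕ V → ℂ) →L[ℂ] ℂ, ∀ x, L x = wCoord V x v := by
  by_cases h : v ∈ V
  · exact ⟨ContinuousLinearMap.proj (Sum.inr ⟨v, h⟩), fun x => by simp [wCoord, h]⟩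
  · exact ⟨0, fun x => by simp [wCoord, h]⟩

/-- The formal derivative of `pinnedMap`. -/
def pinnedMapDeriv (E : Finset (Sym2 α)) (a b : α) (z w z' w' : α → ℂ) :
    {e // e ∈ E} ⊕ Fin 3 → ℂ :=
  Sum.elim (fun e => isotropicEdgeDeriv z w z' w' e.1) ![z' a, w' a, z' b - z' a]

theorem exists_hasStrictFDerivAt_pinnedMap (V : Finset α) (E : Finset (Sym2 α)) (a b : α)
    (x : V ⊕ V → ℂ) :
    ∃ L : (V ⊕ V → ℂ) →L[ℂ] ({e // e ∈ E} ⊕ Fin 3 → ℂ),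
      HasStrictFDerivAt (fun x => pinnedMap E a b (zCoord V x) (wCoord V x)) L x ∧
      ∀ q, L q = pinnedMapDeriv E a b (zCoord V x) (wCoord V x) (zCoord V q) (wCoord V q) := by
  choose Z hZ using exists_zCoord V
  choose W hW using exists_wCoord V
  suffices h : ∀ i, ∃ L : (V ⊕ V → ℂ) →L[ℂ] ℂ,
      HasStrictFDerivAt (fun x => pinnedMap E a b (zCoord V x) (wCoord V x) i) L x ∧
      ∀ q, L q = pinnedMapDeriv E a b (zCoord V x) (wCoord V x) (zCoord V q) (wCoord V q) i by
    choose L hL hLq using h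
    exact ⟨ContinuousLinearMap.pi L, hasStrictFDerivAt_pi.2 hL, fun q => funext fun i => hLq i q⟩
  have hZd : ∀ v, HasStrictFDerivAt (fun x => zCoord V x v) (Z v) x := fun v => by
    rw [← funext (hZ v)]
    exact (Z v).hasStrictFDerivAt
  have hWd : ∀ v, HasStrictFDerivAt (fun x => wCoord V x v) (W v) x := fun v => by
    rw [← funext (hW v)]
    exact (W v).hasStrictFDerivAt
  rintro (⟨e, he⟩ | i)
  · induction e with | h u v =>
    refine ⟨_, ((hZd u).sub (hZd v)).mul ((hWd u).sub (hWd v)), fun q => ?_⟩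
    simp [pinnedMapDeriv, hZ, hW]
  · fin_cases i
    · exact ⟨Z a, hZd a, hZ a⟩
    · exact ⟨W a, hWd a, hW a⟩
    · exact ⟨Z b - Z a, (hZd b).sub (hZd a), fun q => by simp [pinnedMapDeriv, hZ]⟩

theorem IsRegularAt.exists_pinnedMapDeriv_eq {E : Finset (Sym2 α)} {z w : α → ℂ}
    (h : IsRegularAt E z w) {a b : α} (hab : z a ≠ z b) (μ : {e // e ∈ E} ⊕ Fin 3 → ℂ) :
    ∃ z' w', pinnedMapDeriv E a b z w z' w' = μ := by
  obtain ⟨z', w', h'⟩ := h fun e => if he : e ∈ E then μ (Sum.inl ⟨e, he⟩) else 0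
  have hba : z b - z a ≠ 0 := sub_ne_zero.2 hab.symm
  let θ := (μ (Sum.inr 2) - (z' b - z' a)) / (z b - z a)
  have hθ : θ * (z b - z a) = μ (Sum.inr 2) - (z' b - z' a) := div_mul_cancel₀ _ hba
  refine ⟨fun v => z' v + θ * z v + (μ (Sum.inr 0) - z' a - θ * z a),
    fun v => w' v - θ * w v + (μ (Sum.inr 1) - w' a + θ * w a), ?_⟩
  ext (⟨e, he⟩ | i)
  · simp only [pinnedMapDeriv, Sum.elim_inl]
    rw [isotropicEdgeDeriv_add, h' e he, dif_pos he]
  · fin_cases i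
    · simp [pinnedMapDeriv]
    · simp [pinnedMapDeriv]
    · simp [pinnedMapDeriv]
      linear_combination hθ

theorem IsRegularAt.algebraicIndependent_pinnedPoly {V : Finset α} {E : Finset (Sym2 α)}
    (hEV : ∀ e ∈ E, ∀ v ∈ e, v ∈ V) {z w : α → ℂ} (h : IsRegularAt E z w) {a b : α}
    (ha : a ∈ V) (hb : b ∈ V) (hab : a ≠ b) :
    AlgebraicIndependent ℂ (pinnedPoly V E a b) := by
  obtain ⟨z, w, h, hz⟩ := h.exists_ne hab
  rw [algebraicIndependent_iff_forall_eval]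
  intro P hP
  simp only [eval_pinnedPoly] at hP
  let x : V ⊕ V → ℂ := Sum.elim (fun v => z v) (fun v => w v)
  obtain ⟨L, hL, hLq⟩ := exists_hasStrictFDerivAt_pinnedMap V E a b x
  have hsurj : L.range = ⊤ := by
    refine LinearMap.range_eq_top.2 fun μ => ?_
    obtain ⟨z', w', h'⟩ := h.exists_pinnedMapDeriv_eq hz μ
    refine ⟨Sum.elim (fun v => z' v) (fun v => w' v), ?_⟩
    refine (hLq _).trans (Eq.trans ?_ h')
    ext (⟨e, he⟩ | i)
    · have := hEV e he
      induction e with | h u v =>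
      simp [pinnedMapDeriv, zCoord, wCoord, x, this u, this v]
    · fin_cases i <;> simp [pinnedMapDeriv, zCoord, wCoord, ha, hb]
  have hnhds := hL.map_nhds_eq_of_surj hsurj
  refine eq_zero_of_eventually_eval_eq_zero
    (y := pinnedMap E a b (zCoord V x) (wCoord V x)) ?_
  rw [← hnhds, eventually_map]
  exact Eventually.of_forall hP

/-- A polynomial relation between pinned edge lengths holds for all values of the pins. -/
theorem eval_sumElim_eq_zero {E : Finset (Sym2 α)} {a b : α} (hab : a ≠ b)
    {P : MvPolynomial ({e // e ∈ E} ⊕ Fin 3) ℂ}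
    (hP : ∀ z w : α → ℂ, eval (pinnedMap E a b z w) P = 0) (z w : α → ℂ) {μ : Fin 3 → ℂ}
    (hμ : μ 2 ≠ 0) :
    eval (Sum.elim (fun e : {e // e ∈ E} => isotropicEdge z w e.1) μ) P = 0 := by
  have key : ∀ z w : α → ℂ, z a ≠ z b →
      eval (Sum.elim (fun e : {e // e ∈ E} => isotropicEdge z w e.1) μ) P = 0 := by
    intro z w hz
    have hba : z b - z a ≠ 0 := sub_ne_zero.2 hz.symm
    let ζ := μ 2 / (z b - z a)
    have hζ : ζ ≠ 0 := div_ne_zero hμ hba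
    rw [← hP (fun v => ζ * z v + (μ 0 - ζ * z a)) fun v => ζ⁻¹ * w v + (μ 1 - ζ⁻¹ * w a)]
    congr 2
    ext (e | i)
    · exact (isotropicEdge_smul_add hζ _ _ _).symm
    · have h2 : ζ * (z b - z a) = μ 2 := div_mul_cancel₀ _ hba
      fin_cases i
      · simp [pinnedMap]
      · simp [pinnedMap]
      · simp [pinnedMap]
        linear_combination -h2
  let g : ℂ → ℂ := fun t =>
    eval (Sum.elim (fun e : {e // e ∈ E} =>
      isotropicEdge (fun v => z v + t * Pi.single (M := fun _ => ℂ) b 1 v) w e.1) μ) P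
  have hg : Continuous g := by
    refine P.continuous_eval.comp (continuous_pi ?_)
    rintro (⟨e, he⟩ | i)
    · induction e with | h u v =>
      simp only [Sum.elim_inl, isotropicEdge_mk]
      fun_prop
    · exact continuous_const
  have hg0 : g = fun _ => 0 := by
    refine hg.ext_on (dense_compl_singleton (z a - z b)) continuous_const fun t ht => key _ _ ?_
    simp only [Pi.single_eq_of_ne hab, Pi.single_eq_same, mul_zero, add_zero, mul_one]
    intro h
    exact ht (by rw [Set.mem_singleton_iff]; linear_combination -h)
  simpa [g] using congrFun hg0 0

theorem algebraicIndependent_pinnedPoly_of_dominant {V' : Finset α} {E E' : Finset (Sym2 α)}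
    {F : MvPolynomial {e // e ∈ E} ℂ} (hF : F ≠ 0)
    (hdom : ∀ lam, eval lam F ≠ 0 → ∃ z w : α → ℂ, ∀ e : {e // e ∈ E},
      isotropicEdge z w e.1 = lam e)
    (hE' : E' ⊆ E) (hEV : ∀ e ∈ E', ∀ v ∈ e, v ∈ V') {a b : α} (ha : a ∈ V') (hb : b ∈ V')
    (hab : a ≠ b) : AlgebraicIndependent ℂ (pinnedPoly V' E' a b) := by
  rw [algebraicIndependent_pinnedPoly_iff hEV ha hb]
  intro P hP
  let ι : {e // e ∈ E'} ⊕ Fin 3 → {e // e ∈ E} ⊕ Fin 3 :=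
    Sum.map (fun e => ⟨e.1, hE' e.2⟩) id
  have hι : Function.Injective ι :=
    Sum.map_injective.2 ⟨fun e e' h => Subtype.ext (Subtype.mk.inj h), Function.injective_id⟩
  have hprod : rename ι P * (rename Sum.inl F * X (Sum.inr 2)) = 0 := by
    refine MvPolynomial.funext fun y => ?_
    simp only [map_mul, eval_rename, eval_X, map_zero, mul_eq_zero]
    by_contra! h
    obtain ⟨h1, h2, h3⟩ := h
    obtain ⟨z, w, hzw⟩ := hdom _ h2
    refine h1 ?_
    rw [← eval_sumElim_eq_zero hab hP z w (μ := fun i => y (Sum.inr i)) h3]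
    congr 2
    ext (e | i)
    · exact (hzw ⟨e.1, hE' e.2⟩).symm
    · rfl
  have hF' : rename Sum.inl F * X (Sum.inr (2 : Fin 3)) ≠ 0 :=
    mul_ne_zero (fun h => hF (rename_injective _ Sum.inl_injective (by rw [h, map_zero])))
      (X_ne_zero _)
  exact rename_injective ι hι (by rw [(mul_eq_zero.1 hprod).resolve_right hF', map_zero])

end PinnedFamily

section Transformations

open Complex

/-- The change to isotropic coordinates `z = x + iy`, `w = x - iy`. -/
noncomputable def isotropicEquiv (β : Type*) : (β → ℂ × ℂ) ≃ (β ⊕ β → ℂ) where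
  toFun r := Sum.elim (fun v => (r v).1 + I * (r v).2) (fun v => (r v).1 - I * (r v).2)
  invFun x v := ((x (Sum.inl v) + x (Sum.inr v)) / 2, -I * (x (Sum.inl v) - x (Sum.inr v)) / 2)
  left_inv r := by
    ext v
    · simp
    · simp only [Sum.elim_inl, Sum.elim_inr]
      linear_combination -(r v).2 * I_sq
  right_inv x := by
    ext (v | v)
    · simp only [Sum.elim_inl]
      linear_combination -(x (Sum.inl v) - x (Sum.inr v)) / 2 * I_sq
    · simp only [Sum.elim_inr]
      linear_combination (x (Sum.inl v) - x (Sum.inr v)) / 2 * I_sq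

theorem isotropicEquiv_inl {β : Type*} (r : β → ℂ × ℂ) (v : β) :
    isotropicEquiv β r (Sum.inl v) = (r v).1 + I * (r v).2 := rfl

theorem isotropicEquiv_inr {β : Type*} (r : β → ℂ × ℂ) (v : β) :
    isotropicEquiv β r (Sum.inr v) = (r v).1 - I * (r v).2 := rfl

theorem edgeMap_eq_isotropicEdge {α : Type*} [DecidableEq α] (V : Finset α) (E : Finset (Sym2 α))
    (r : V → ℂ × ℂ) (e : {e // e ∈ E}) :
    edgeMap V E r e =
      isotropicEdge (zCoord V (isotropicEquiv V r)) (wCoord V (isotropicEquiv V r)) e.1 := by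
  have hz : ∀ v, zCoord V (isotropicEquiv V r) v =
      (extendR V r v).1 + I * (extendR V r v).2 := fun v => by
    by_cases h : v ∈ V <;> simp [zCoord, extendR, h, isotropicEquiv_inl]
  have hw : ∀ v, wCoord V (isotropicEquiv V r) v =
      (extendR V r v).1 - I * (extendR V r v).2 := fun v => by
    by_cases h : v ∈ V <;> simp [wCoord, extendR, h, isotropicEquiv_inr]
  obtain ⟨e, he⟩ := e
  induction e with | h a b =>
  simp only [isotropicEdge_mk, hz, hw]
  change sd (extendR V r a) (extendR V r b) = _
  rw [sd]
  linear_combination ((extendR V r a).2 - (extendR V r b).2) ^ 2 * I_sq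

theorem exists_isTransf_iff {β : Type*} {r s : β → ℂ × ℂ} :
    (∃ t, IsTransf t ∧ s = fun v => t (r v)) ↔ ∃ ζ p q : ℂ, ζ ≠ 0 ∧ ∀ v,
      isotropicEquiv β s (Sum.inl v) = ζ * isotropicEquiv β r (Sum.inl v) + p ∧
      isotropicEquiv β s (Sum.inr v) = ζ⁻¹ * isotropicEquiv β r (Sum.inr v) + q := by
  simp only [isotropicEquiv_inl, isotropicEquiv_inr]
  constructor
  · rintro ⟨t, ⟨c, d, u, v, hcd, ht⟩, rfl⟩
    have h1 : (c + I * d) * (c - I * d) = 1 := by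
      linear_combination hcd - d ^ 2 * I_sq
    refine ⟨c + I * d, u + I * v, u - I * v, left_ne_zero_of_mul_eq_one h1, fun x => ?_⟩
    rw [← eq_inv_of_mul_eq_one_right h1]
    simp only [ht]
    constructor
    · linear_combination -d * (r x).2 * I_sq
    · linear_combination -d * (r x).2 * I_sq
  · rintro ⟨ζ, p, q, hζ, h⟩
    have hinv : ζ * ζ⁻¹ = 1 := mul_inv_cancel₀ hζ
    refine ⟨_, ⟨(ζ + ζ⁻¹) / 2, -I * (ζ - ζ⁻¹) / 2, (p + q) / 2, -I * (p - q) / 2, ?_,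
      fun _ => rfl⟩, ?_⟩
    · linear_combination hinv + (ζ - ζ⁻¹) ^ 2 / 4 * I_sq
    · ext v
      · obtain ⟨h1, h2⟩ := h v
        linear_combination (h1 + h2) / 2
      · obtain ⟨h1, h2⟩ := h v
        linear_combination -I * (h1 - h2) / 2 + ((s v).2 - (ζ + ζ⁻¹) / 2 * (r v).2) * I_sq

/-- The orbit of `r` under the transformation group, inside `S`. -/
def transfClass {β : Type*} (S : Set (β → ℂ × ℂ)) (r : β → ℂ × ℂ) : Set (β → ℂ × ℂ) :=
  {s | s ∈ S ∧ ∃ t, IsTransf t ∧ s = fun v => t (r v)}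

theorem exists_isTransf_refl {β : Type*} (r : β → ℂ × ℂ) :
    ∃ t, IsTransf t ∧ r = fun v => t (r v) :=
  exists_isTransf_iff.2 ⟨1, 0, 0, one_ne_zero, by simp⟩

theorem exists_isTransf_symm {β : Type*} {r s : β → ℂ × ℂ}
    (h : ∃ t, IsTransf t ∧ s = fun v => t (r v)) : ∃ t, IsTransf t ∧ r = fun v => t (s v) := by
  rw [exists_isTransf_iff] at h ⊢
  obtain ⟨ζ, p, q, hζ, h⟩ := h
  refine ⟨ζ⁻¹, -ζ⁻¹ * p, -ζ * q, inv_ne_zero hζ, fun v => ?_⟩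
  rw [(h v).1, (h v).2]
  constructor <;> field_simp <;> ring

theorem exists_isTransf_trans {β : Type*} {r s u : β → ℂ × ℂ}
    (h : ∃ t, IsTransf t ∧ s = fun v => t (r v)) (h' : ∃ t, IsTransf t ∧ u = fun v => t (s v)) :
    ∃ t, IsTransf t ∧ u = fun v => t (r v) := by
  rw [exists_isTransf_iff] at h h' ⊢
  obtain ⟨ζ, p, q, hζ, h⟩ := h
  obtain ⟨ζ', p', q', hζ', h'⟩ := h'
  refine ⟨ζ' * ζ, ζ' * p + p', ζ'⁻¹ * q + q', mul_ne_zero hζ' hζ, fun v => ?_⟩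
  rw [(h' v).1, (h' v).2, (h v).1, (h v).2, mul_inv]
  constructor <;> ring

theorem transfClass_eq_of_exists {β : Type*} {S : Set (β → ℂ × ℂ)} {r s : β → ℂ × ℂ}
    (h : ∃ t, IsTransf t ∧ s = fun v => t (r v)) : transfClass S s = transfClass S r :=
  Set.ext fun _ => and_congr_right fun _ =>
    ⟨exists_isTransf_trans h, exists_isTransf_trans (exists_isTransf_symm h)⟩

theorem exists_of_transfClass_eq {β : Type*} {S : Set (β → ℂ × ℂ)} {r s : β → ℂ × ℂ}
    (hs : s ∈ S) (h : transfClass S s = transfClass S r) :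
    ∃ t, IsTransf t ∧ s = fun v => t (r v) := by
  have : s ∈ transfClass S s := ⟨hs, exists_isTransf_refl s⟩
  rw [h] at this
  exact this.2

theorem TClasses_eq_image {β : Type*} (S : Set (β → ℂ × ℂ)) :
    TClasses S = transfClass S '' S := by
  ext C
  exact exists_congr fun r => and_congr_right fun _ => eq_comm

theorem TClasses_univ_eq_singleton {β : Type*} [Subsingleton β] :
    TClasses (Set.univ : Set (β → ℂ × ℂ)) = {Set.univ} := by
  have h : ∀ r : β → ℂ × ℂ, transfClass Set.univ r = Set.univ := fun r =>
    Set.eq_univ_of_forall fun s => ⟨Set.mem_univ _, exists_isTransf_iff.2 (by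
      rcases isEmpty_or_nonempty β with hβ | ⟨⟨b⟩⟩
      · exact ⟨1, 0, 0, one_ne_zero, fun v => isEmptyElim v⟩
      · refine ⟨1, isotropicEquiv β s (Sum.inl b) - isotropicEquiv β r (Sum.inl b),
          isotropicEquiv β s (Sum.inr b) - isotropicEquiv β r (Sum.inr b), one_ne_zero,
          fun v => ?_⟩
        rw [Subsingleton.elim v b]
        constructor <;> simp)⟩
  rw [TClasses_eq_image, Set.image_congr fun r _ => h r, Set.image_univ, Set.range_const]

end Transformations

section PinnedFiber

variable {α : Type*} [DecidableEq α]

/-- The isotropic coordinates of the `lam`-compatible realizations pinned by `μ`. -/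
def pinnedFiber (V : Finset α) (E : Finset (Sym2 α)) (a b : α) (lam : {e // e ∈ E} → ℂ)
    (μ : Fin 3 → ℂ) : Set (V ⊕ V → ℂ) :=
  {x | ∀ i, MvPolynomial.eval x (pinnedPoly V E a b i) = Sum.elim lam μ i}

variable {V : Finset α} {E : Finset (Sym2 α)} {a b : α} {lam : {e // e ∈ E} → ℂ} {μ : Fin 3 → ℂ}

theorem mem_fiber_iff {r : V → ℂ × ℂ} : r ∈ fiber V E lam ↔ ∀ e : {e // e ∈ E},
    isotropicEdge (zCoord V (isotropicEquiv V r)) (wCoord V (isotropicEquiv V r)) e.1 = lam e := by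
  simp only [← edgeMap_eq_isotropicEdge]
  exact funext_iff

theorem isotropicEquiv_mem_pinnedFiber_iff {r : V → ℂ × ℂ} (ha : a ∈ V) (hb : b ∈ V) :
    isotropicEquiv V r ∈ pinnedFiber V E a b lam μ ↔ r ∈ fiber V E lam ∧
      isotropicEquiv V r (Sum.inl ⟨a, ha⟩) = μ 0 ∧ isotropicEquiv V r (Sum.inr ⟨a, ha⟩) = μ 1 ∧
      isotropicEquiv V r (Sum.inl ⟨b, hb⟩) - isotropicEquiv V r (Sum.inl ⟨a, ha⟩) = μ 2 := by
  rw [mem_fiber_iff]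
  change (∀ i, MvPolynomial.eval _ (pinnedPoly V E a b i) = _) ↔ _
  simp only [eval_pinnedPoly, Sum.forall]
  refine and_congr Iff.rfl ?_
  rw [Fin.forall_fin_succ, Fin.forall_fin_two]
  simp [pinnedMap, zCoord, wCoord, ha, hb]

theorem symm_mem_fiber (ha : a ∈ V) (hb : b ∈ V) {x : V ⊕ V → ℂ}
    (hx : x ∈ pinnedFiber V E a b lam μ) : (isotropicEquiv V).symm x ∈ fiber V E lam := by
  rw [← (isotropicEquiv V).apply_symm_apply x,
    isotropicEquiv_mem_pinnedFiber_iff ha hb] at hx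
  exact hx.1

theorem mapsTo_pinnedFiber (ha : a ∈ V) (hb : b ∈ V) :
    Set.MapsTo (fun x => transfClass (fiber V E lam) ((isotropicEquiv V).symm x))
      (pinnedFiber V E a b lam μ) (TClasses (fiber V E lam)) := fun x hx => by
  rw [TClasses_eq_image]
  exact Set.mem_image_of_mem _ (symm_mem_fiber ha hb hx)

theorem injOn_pinnedFiber (ha : a ∈ V) (hb : b ∈ V) (hμ : μ 2 ≠ 0) :
    Set.InjOn (fun x => transfClass (fiber V E lam) ((isotropicEquiv V).symm x))
      (pinnedFiber V E a b lam μ) := by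
  intro x hx y hy hxy
  obtain ⟨ζ, p, q, hζ, h⟩ := exists_isTransf_iff.1
    (exists_of_transfClass_eq (symm_mem_fiber ha hb hx) hxy)
  rw [← (isotropicEquiv V).apply_symm_apply x, isotropicEquiv_mem_pinnedFiber_iff ha hb] at hx
  rw [← (isotropicEquiv V).apply_symm_apply y, isotropicEquiv_mem_pinnedFiber_iff ha hb] at hy
  simp only [Equiv.apply_symm_apply] at hx hy h
  obtain ⟨-, hx1, hx2, hx3⟩ := hx
  obtain ⟨-, hy1, hy2, hy3⟩ := hy
  have h1 : (ζ - 1) * μ 2 = 0 := by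
    linear_combination (h ⟨a, ha⟩).1 - (h ⟨b, hb⟩).1 + hx3 - ζ * hy3
  obtain rfl : ζ = 1 := sub_eq_zero.1 ((mul_eq_zero.1 h1).resolve_right hμ)
  simp only [inv_one, one_mul] at h
  obtain rfl : p = 0 := by linear_combination -(h ⟨a, ha⟩).1 + hx1 - hy1
  obtain rfl : q = 0 := by linear_combination -(h ⟨a, ha⟩).2 + hx2 - hy2
  ext (v | v)
  · simpa using (h v).1
  · simpa using (h v).2

theorem surjOn_pinnedFiber (hEV : ∀ e ∈ E, ∀ v ∈ e, v ∈ V) (ha : a ∈ V) (hb : b ∈ V) (hμ : μ 2 ≠ 0)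
    (hab : ∀ r ∈ fiber V E lam,
      isotropicEquiv V r (Sum.inl ⟨a, ha⟩) ≠ isotropicEquiv V r (Sum.inl ⟨b, hb⟩)) :
    Set.SurjOn (fun x => transfClass (fiber V E lam) ((isotropicEquiv V).symm x))
      (pinnedFiber V E a b lam μ) (TClasses (fiber V E lam)) := by
  rw [TClasses_eq_image]
  rintro _ ⟨r, hr, rfl⟩
  have hba := sub_ne_zero.2 (hab r hr).symm
  set x := isotropicEquiv V r with hx
  let ζ := μ 2 / (x (Sum.inl ⟨b, hb⟩) - x (Sum.inl ⟨a, ha⟩))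
  have hζ : ζ ≠ 0 := div_ne_zero hμ hba
  have h2 : ζ * (x (Sum.inl ⟨b, hb⟩) - x (Sum.inl ⟨a, ha⟩)) = μ 2 := div_mul_cancel₀ _ hba
  let p := μ 0 - ζ * x (Sum.inl ⟨a, ha⟩)
  let q := μ 1 - ζ⁻¹ * x (Sum.inr ⟨a, ha⟩)
  let y : V ⊕ V → ℂ := Sum.elim (fun v => ζ * x (Sum.inl v) + p) (fun v => ζ⁻¹ * x (Sum.inr v) + q)
  refine ⟨y, ?_, transfClass_eq_of_exists (exists_isTransf_iff.2
    ⟨ζ, p, q, hζ, fun v => ?_⟩)⟩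
  · rw [← (isotropicEquiv V).apply_symm_apply y, isotropicEquiv_mem_pinnedFiber_iff ha hb,
      mem_fiber_iff, Equiv.apply_symm_apply]
    refine ⟨fun e => ?_, ?_, ?_, ?_⟩
    · rw [← mem_fiber_iff.1 hr e, ← hx]
      refine Eq.trans ?_ (isotropicEdge_smul_add hζ p q e.1)
      exact isotropicEdge_congr (fun v hv => by simp [zCoord, y, hEV e.1 e.2 v hv])
        fun v hv => by simp [wCoord, y, hEV e.1 e.2 v hv]
    · simp [y, p]
    · simp [y, q]
    · simp only [y, Sum.elim_inl]
      linear_combination h2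
  · rw [Equiv.apply_symm_apply]
    exact ⟨rfl, rfl⟩

end PinnedFiber

section Rigidity

variable {α : Type*} {V : Finset α} {E : Finset (Sym2 α)}

theorem IsGraph.eq_empty_of_card_eq_one (h : IsGraph V E) (hV : V.card = 1) : E = ∅ := by
  refine Finset.eq_empty_of_forall_notMem fun e he => ?_
  obtain ⟨hd, hV'⟩ := h e he
  induction e with | h a b =>
  exact hd (Sym2.mk_isDiag_iff.2 (Finset.card_le_one.1 hV.le a
    (hV' a (Sym2.mem_mk_left a b)) b (hV' b (Sym2.mem_mk_right a b))))

variable [DecidableEq α]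

theorem IsSparse.isLamanSparse (h : IsSparse V E) : IsLamanSparse E := by
  refine ⟨fun e he => (h.1 e he).1, fun X hX => ?_⟩
  rcases le_or_gt 2 (X ∩ V).card with hc | hc
  · have := h.2 (X ∩ V) (inducedEdges E X)
      ⟨fun e he => ⟨(h.1 e (mem_inducedEdges.1 he).1).1, fun v hv => Finset.mem_inter.2
        ⟨(mem_inducedEdges.1 he).2 v hv, (h.1 e (mem_inducedEdges.1 he).1).2 v hv⟩⟩,
        Finset.inter_subset_right, fun e he => (mem_inducedEdges.1 he).1⟩ hc
    have hle := Finset.card_le_card (Finset.inter_subset_left : X ∩ V ⊆ X)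
    omega
  · have hempty : inducedEdges E X = ∅ := by
      refine Finset.eq_empty_of_forall_notMem fun e he => ?_
      rw [mem_inducedEdges] at he
      obtain ⟨hd, hV⟩ := h.1 e he.1
      induction e with | h a b =>
      refine hd (Sym2.mk_isDiag_iff.2 (Finset.card_le_one.1 (Nat.lt_succ_iff.1 hc) a ?_ b ?_))
      · exact Finset.mem_inter.2 ⟨he.2 a (Sym2.mem_mk_left a b), hV a (Sym2.mem_mk_left a b)⟩
      · exact Finset.mem_inter.2 ⟨he.2 b (Sym2.mem_mk_right a b), hV b (Sym2.mem_mk_right a b)⟩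
    rw [hempty, Finset.card_empty]
    omega

/-- For a general edge length assignment, the number of realizations modulo transformations is a
fixed positive number. -/
def IsMinimallyRigid (V : Finset α) (E : Finset (Sym2 α)) : Prop :=
  ∃ (n : ℕ) (F : MvPolynomial {e // e ∈ E} ℂ), 0 < n ∧ F ≠ 0 ∧
    ∀ lam : {e // e ∈ E} → ℂ, MvPolynomial.eval lam F ≠ 0 → (TClasses (fiber V E lam)).ncard = n

theorem isMinimallyRigid_of_card_eq_one (hG : IsGraph V E) (hV : V.card = 1) :
    IsMinimallyRigid V E := by
  refine ⟨1, 1, one_pos, one_ne_zero, fun lam _ => ?_⟩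
  have : Subsingleton V := Finset.card_le_one_iff_subsingleton_coe.1 hV.le
  have hE := hG.eq_empty_of_card_eq_one hV
  have hfiber : fiber V E lam = Set.univ := Set.eq_univ_of_forall fun r =>
    funext fun e => absurd e.2 (by simp [hE])
  rw [hfiber, TClasses_univ_eq_singleton, Set.ncard_singleton]

theorem IsSparse.isMinimallyRigid (h : IsSparse V E)
    (hcard : E.card + 3 = 2 * V.card) : IsMinimallyRigid V E := by
  have hEV : ∀ e ∈ E, ∀ v ∈ e, v ∈ V := fun e he => (h.1 e he).2
  obtain ⟨e₀, he₀⟩ : E.Nonempty := Finset.card_pos.1 (by omega)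
  obtain ⟨a, b, rfl⟩ : ∃ a b, e₀ = s(a, b) := by
    induction e₀ with | h a b => exact ⟨a, b, rfl⟩
  have ha := hEV _ he₀ a (Sym2.mem_mk_left a b)
  have hb := hEV _ he₀ b (Sym2.mem_mk_right a b)
  have hab : a ≠ b := fun hab => (h.1 _ he₀).1 (Sym2.mk_isDiag_iff.2 hab)
  obtain ⟨z, w, hreg⟩ := h.isLamanSparse.exists_isRegularAt hEV
  obtain ⟨n, hn, G, hG, hGn⟩ := exists_ncard_fiber_eq
    (hreg.algebraicIndependent_pinnedPoly hEV ha hb hab) (by simp; omega)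
  obtain ⟨y, hy⟩ := exists_eval_ne_zero
    (mul_ne_zero hG (MvPolynomial.X_ne_zero (R := ℂ) (Sum.inr 2)))
  rw [map_mul, MvPolynomial.eval_X] at hy
  set μ : Fin 3 → ℂ := y ∘ Sum.inr with hμ
  let H : MvPolynomial {e // e ∈ E} ℂ :=
    MvPolynomial.bind₁ (Sum.elim MvPolynomial.X (MvPolynomial.C ∘ μ)) G
  have hH : ∀ lam, MvPolynomial.eval lam H = MvPolynomial.eval (Sum.elim lam μ) G := fun lam => by
    simp only [H, MvPolynomial.eval, MvPolynomial.eval₂Hom_bind₁]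
    congr 2
    ext (e | i) <;> simp
  have hH0 : H ≠ 0 := fun h0 => by
    have := hH (y ∘ Sum.inl)
    rw [h0, map_zero, hμ, Sum.elim_comp_inl_inr] at this
    exact hy (by rw [← this, zero_mul])
  refine ⟨n, H * MvPolynomial.X ⟨s(a, b), he₀⟩, hn,
    mul_ne_zero hH0 (MvPolynomial.X_ne_zero _), fun lam hlam => ?_⟩
  rw [map_mul, MvPolynomial.eval_X, hH] at hlam
  have hne : ∀ r ∈ fiber V E lam,
      isotropicEquiv V r (Sum.inl ⟨a, ha⟩) ≠ isotropicEquiv V r (Sum.inl ⟨b, hb⟩) := by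
    intro r hr heq
    apply right_ne_zero_of_mul hlam
    rw [← mem_fiber_iff.1 hr]
    simp [zCoord, ha, hb, heq]
  have hμ2 : μ 2 ≠ 0 := right_ne_zero_of_mul hy
  have hbij : Set.BijOn (fun x => transfClass (fiber V E lam) ((isotropicEquiv V).symm x))
      (pinnedFiber V E a b lam μ) (TClasses (fiber V E lam)) :=
    ⟨mapsTo_pinnedFiber ha hb, injOn_pinnedFiber ha hb hμ2,
      surjOn_pinnedFiber hEV ha hb hμ2 hne⟩
  rw [← hbij.image_eq, hbij.injOn.ncard_image]
  exact hGn _ (left_ne_zero_of_mul hlam)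

theorem IsMinimallyRigid.isTight (h : IsMinimallyRigid V E) (hG : IsGraph V E)
    (hV : V.Nonempty) : IsTight V E := by
  obtain ⟨n, F, hn, hF, hFn⟩ := h
  have hdom : ∀ lam, MvPolynomial.eval lam F ≠ 0 →
      ∃ z w : α → ℂ, ∀ e : {e // e ∈ E}, isotropicEdge z w e.1 = lam e := fun lam hlam => by
    obtain ⟨_, r, hr, -⟩ : (TClasses (fiber V E lam)).Nonempty :=
      Set.nonempty_of_ncard_ne_zero (by rw [hFn lam hlam]; exact hn.ne')
    exact ⟨_, _, mem_fiber_iff.1 hr⟩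
  have hsparse : IsSparse V E := by
    refine ⟨hG, fun V' E' hsub hV' => ?_⟩
    obtain ⟨a, ha, b, hb, hab⟩ := Finset.one_lt_card.1 hV'
    have := (algebraicIndependent_pinnedPoly_of_dominant hF hdom hsub.2.2
      (fun e he => (hsub.1 e he).2) ha hb hab).card_le_card
    simp only [Fintype.card_sum, Fintype.card_coe, Fintype.card_fin] at this
    omega
  refine ⟨hsparse, or_iff_not_imp_left.2 fun hV1 => ?_⟩
  have hV2 : 2 ≤ V.card := by
    have := hV.card_pos
    omega
  have hle := hsparse.2 V E ⟨hG, subset_rfl, subset_rfl⟩ hV2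
  by_contra hlt
  obtain ⟨a, ha, b, hb, hab⟩ := Finset.one_lt_card.1 hV2
  obtain ⟨lam, hlam, hinf⟩ := exists_infinite_fiber
    (algebraicIndependent_pinnedPoly_of_dominant hF hdom subset_rfl
      (fun e he => (hG e he).2) ha hb hab)
    (by
      simp only [Fintype.card_sum, Fintype.card_coe, Fintype.card_fin]
      omega)
    (mul_ne_zero ((map_ne_zero_iff _ (MvPolynomial.rename_injective _ Sum.inl_injective)).2 hF)
      (MvPolynomial.X_ne_zero (R := ℂ) (Sum.inr 2)))
  rw [map_mul, MvPolynomial.eval_X, MvPolynomial.eval_rename] at hlam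
  have hclasses : (TClasses (fiber V E (lam ∘ Sum.inl))).Infinite :=
    Set.infinite_of_injOn_mapsTo
      (injOn_pinnedFiber (μ := lam ∘ Sum.inr) ha hb (right_ne_zero_of_mul hlam))
      (mapsTo_pinnedFiber ha hb) (by
        rwa [pinnedFiber, Sum.elim_comp_inl_inr])
  have := hFn _ (left_ne_zero_of_mul hlam)
  rw [hclasses.ncard] at this
  omega

end Rigidity

/-- **Geiringer–Laman.** A (nonempty) graph is minimally rigid —
i.e. for a general edge length assignment `λ` the set `E_G⁻¹(λ)` has exactly
`n ≥ 1` equivalence classes modulo the transformation group `T` — if and only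
if it is tight. -/
theorem minimally_rigid_iff_tight
    {α : Type*} [DecidableEq α]
    (V : Finset α) (E : Finset (Sym2 α))
    (hGraph : IsGraph V E) (hV : V.Nonempty) :
    (∃ (n : ℕ) (F : MvPolynomial {e // e ∈ E} ℂ), 0 < n ∧ F ≠ 0 ∧
        ∀ lam : {e // e ∈ E} → ℂ, MvPolynomial.eval lam F ≠ 0 →
          (TClasses (fiber V E lam)).ncard = n) ↔
      IsTight V E := by
  refine ⟨fun h => IsMinimallyRigid.isTight h hGraph hV, fun h => ?_⟩
  rcases eq_or_ne V.card 1 with h1 | h1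
  · exact isMinimallyRigid_of_card_eq_one hGraph h1
  · have hV' := hV.card_pos
    have hcard := h.2.resolve_left h1
    exact h.1.isMinimallyRigid (by omega)
end
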